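/- arXiv:2309.11481 — 4 statements merged into one kernel-verified Lean document; each statement's English description precedes it below -/
import Mathlib

section
/- Assume d ≥ 4, the spectral radius of A_Q is strictly less than 1, λ₂ = μ and λ_{d−1} = L (i.e., both extreme eigenvalues of Q have multiplicity at least two). Then r_ℝ = r_ℂ = 1/H∞. -/
open Matrix
open scoped Matrix.Norms.L2Operator

/-- `b_λ := αλ(1+ν) − (1+β)`. -/
noncomputable def bCoef (α β ν lam : ℝ) : ℝ := α * lam * (1 + ν) - (1 + β)

/-- `c_λ := β − αλν`. -/
noncomputable def cCoef (α β ν lam : ℝ) : ℝ := β - α * lam * ν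

/-- `r_λ` as in Theorem `thm-h-inf`. -/
noncomputable def rCoef (α β ν lam : ℝ) : ℝ :=
  if 0 < cCoef α β ν lam ∧
      |bCoef α β ν lam| * (1 + cCoef α β ν lam) / (4 * cCoef α β ν lam) < 1 then
    |1 - cCoef α β ν lam| * Real.sqrt (1 - (bCoef α β ν lam) ^ 2 / (4 * cCoef α β ν lam))
  else
    |(|1 + cCoef α β ν lam| - |bCoef α β ν lam|)|

/-- The (complex) GMM system matrix `A_Q` built from the eigendecomposition `Q = UΛUᵀ`. -/
noncomputable def AQc {d : ℕ} (α β ν : ℝ) (Q : Matrix (Fin d) (Fin d) ℝ) :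
    Matrix (Fin d ⊕ Fin d) (Fin d ⊕ Fin d) ℂ :=
  Matrix.fromBlocks
    ((1 + β : ℂ) • (1 : Matrix (Fin d) (Fin d) ℂ)
      - ((α * (1 + ν) : ℝ) : ℂ) • (Q.map Complex.ofReal))
    ((-(β : ℂ)) • (1 : Matrix (Fin d) (Fin d) ℂ)
      + ((α * ν : ℝ) : ℂ) • (Q.map Complex.ofReal))
    (1 : Matrix (Fin d) (Fin d) ℂ) (0 : Matrix (Fin d) (Fin d) ℂ)

/-- The (complex) GMM input matrix `B = [−αI; 0]`. -/
noncomputable def Bc {d : ℕ} (α : ℝ) : Matrix (Fin d ⊕ Fin d) (Fin d) ℂ :=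
  Matrix.fromRows ((-(α : ℂ)) • (1 : Matrix (Fin d) (Fin d) ℂ)) 0

/-- The (complex) GMM output matrix `T = (1/√2)·[Λ^{1/2}Uᵀ, 0]`. -/
noncomputable def Tc {d : ℕ} (lam : Fin d → ℝ) (U : Matrix (Fin d) (Fin d) ℝ) :
    Matrix (Fin d) (Fin d ⊕ Fin d) ℂ :=
  ((1 / Real.sqrt 2 : ℝ) : ℂ) • Matrix.fromCols
    ((Matrix.diagonal fun j => ((Real.sqrt (lam j) : ℝ) : ℂ)) * (U.map Complex.ofReal)ᵀ) 0

/-- The complex stability radius of the GMM system `(A_Q, B, T)`. -/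
noncomputable def rComplex {d : ℕ} (α β ν : ℝ) (Q : Matrix (Fin d) (Fin d) ℝ)
    (lam : Fin d → ℝ) (U : Matrix (Fin d) (Fin d) ℝ) : ℝ :=
  sInf {ε : ℝ | ∃ Δ : Matrix (Fin d) (Fin d) ℂ, ‖Δ‖ = ε ∧
    1 ≤ spectralRadius ℂ (AQc α β ν Q + Bc (d := d) α * Δ * Tc lam U)}

/-- The real stability radius of the GMM system `(A_Q, B, T)`. -/
noncomputable def rReal {d : ℕ} (α β ν : ℝ) (Q : Matrix (Fin d) (Fin d) ℝ)
    (lam : Fin d → ℝ) (U : Matrix (Fin d) (Fin d) ℝ) : ℝ :=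
  sInf {ε : ℝ | ∃ Δ : Matrix (Fin d) (Fin d) ℝ, ‖Δ‖ = ε ∧
    1 ≤ spectralRadius ℂ (AQc α β ν Q + Bc (d := d) α * (Δ.map Complex.ofReal) * Tc lam U)}


lemma auxA (β ν s c b : ℝ) (hβ : 0 < β) (hs : 0 < s) (hc : 0 ≤ c) (hcd : c = β - ν * s)
    (hb : b = s - 1 - c) (h0 : c = 0 → b = 0) :
    (1 - b ^ 2 / (4 * c)) / s = (2 * (1 + β) - ν * (1 - β ^ 2) / β) / (4 * β)
      - (1 - β) ^ 2 / (4 * β) * (1 / s) - (β - ν) ^ 2 / (4 * β ^ 2) * (s / c) := by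
  rcases hc.eq_or_lt with h | h
  · have hb0 := h0 h.symm
    have hs1 : s = 1 := by linarith
    have : ν = β := by subst hs1; linarith
    subst this; subst hs1; rw [hb0]
    field_simp; ring
  · subst hb
    have hs' := hs.ne'
    have hc' := h.ne'
    field_simp
    rw [hcd]; ring

lemma auxB (β ν s₁ s₂ t : ℝ) (hβ : 0 < β) (hν : 0 ≤ ν) (ht : 0 ≤ t) (ht1 : t ≤ 1)
    (h1 : 0 < s₁) (h2 : 0 < s₂)
    (hc1 : 0 < β - ν * s₁) (hc2 : 0 < β - ν * s₂) :
    (t * s₁ + (1 - t) * s₂) / (β - ν * (t * s₁ + (1 - t) * s₂)) ≤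
      t * (s₁ / (β - ν * s₁)) + (1 - t) * (s₂ / (β - ν * s₂)) := by
  set c₁ := β - ν * s₁ with e1
  set c₂ := β - ν * s₂ with e2
  have ec : β - ν * (t * s₁ + (1 - t) * s₂) = t * c₁ + (1 - t) * c₂ := by rw [e1, e2]; ring
  have hc : 0 < t * c₁ + (1 - t) * c₂ := by
    rcases ht.eq_or_lt with h | h
    · rw [← h]; linarith
    · have := mul_pos h hc1
      have := mul_nonneg (sub_nonneg.2 ht1) hc2.le
      linarith
  rw [ec, div_le_iff₀ hc]
  have key : (t * (s₁ / c₁) + (1 - t) * (s₂ / c₂)) * (t * c₁ + (1 - t) * c₂)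
      - (t * s₁ + (1 - t) * s₂) = t * (1 - t) * (ν * β * (s₁ - s₂) ^ 2) / (c₁ * c₂) := by
    have e : ν * β * (s₁ - s₂) ^ 2 = (c₂ - c₁) * (s₁ * c₂ - s₂ * c₁) := by rw [e1, e2]; ring
    rw [e]
    have := hc1.ne'
    have := hc2.ne'
    field_simp
    ring
  have : 0 ≤ t * (1 - t) * (ν * β * (s₁ - s₂) ^ 2) / (c₁ * c₂) := by
    have := sub_nonneg.2 ht1
    positivity
  linarith

lemma auxInv (s₁ s₂ t : ℝ) (ht : 0 ≤ t) (ht1 : t ≤ 1) (h1 : 0 < s₁) (h2 : 0 < s₂) :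
    1 / (t * s₁ + (1 - t) * s₂) ≤ t * (1 / s₁) + (1 - t) * (1 / s₂) := by
  have hc : 0 < t * s₁ + (1 - t) * s₂ := by
    rcases ht.eq_or_lt with h | h
    · rw [← h]; linarith
    · have := mul_pos h h1
      have := mul_nonneg (sub_nonneg.2 ht1) h2.le
      linarith
  rw [div_le_iff₀ hc]
  have key : (t * (1 / s₁) + (1 - t) * (1 / s₂)) * (t * s₁ + (1 - t) * s₂)
      - 1 = t * (1 - t) * (s₁ - s₂) ^ 2 / (s₁ * s₂) := by
    field_simp
    ring
  have : 0 ≤ t * (1 - t) * (s₁ - s₂) ^ 2 / (s₁ * s₂) := by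
    have := sub_nonneg.2 ht1
    positivity
  linarith

/-- concavity of `q/s`. -/
lemma auxConc (β ν s₁ s₂ t : ℝ) (hβ : 0 < β) (hν : 0 ≤ ν) (ht : 0 ≤ t) (ht1 : t ≤ 1)
    (h1 : 0 < s₁) (h2 : 0 < s₂)
    (hc1 : 0 ≤ β - ν * s₁) (hc2 : 0 ≤ β - ν * s₂)
    (hb1 : β - ν * s₁ = 0 → s₁ - 1 - (β - ν * s₁) = 0)
    (hb2 : β - ν * s₂ = 0 → s₂ - 1 - (β - ν * s₂) = 0)
    (s : ℝ) (hs : s = t * s₁ + (1 - t) * s₂) (hc : 0 < β - ν * s) :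
    t * ((1 - (s₁ - 1 - (β - ν * s₁)) ^ 2 / (4 * (β - ν * s₁))) / s₁)
      + (1 - t) * ((1 - (s₂ - 1 - (β - ν * s₂)) ^ 2 / (4 * (β - ν * s₂))) / s₂)
      ≤ (1 - (s - 1 - (β - ν * s)) ^ 2 / (4 * (β - ν * s))) / s := by
  have hsp : 0 < s := by
    rw [hs]
    rcases ht.eq_or_lt with h | h
    · rw [← h]; linarith
    · have := mul_pos h h1
      have := mul_nonneg (sub_nonneg.2 ht1) h2.le
      linarith
  rw [auxA β ν s₁ _ _ hβ h1 hc1 rfl rfl hb1, auxA β ν s₂ _ _ hβ h2 hc2 rfl rfl hb2,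
    auxA β ν s _ _ hβ hsp hc.le rfl rfl (fun h => absurd h hc.ne')]
  have i1 := auxInv s₁ s₂ t ht ht1 h1 h2
  rw [← hs] at i1
  have i2 : (β - ν) ^ 2 / (4 * β ^ 2) * (s / (β - ν * s)) ≤
      (β - ν) ^ 2 / (4 * β ^ 2) * (t * (s₁ / (β - ν * s₁)) + (1 - t) * (s₂ / (β - ν * s₂))) := by
    by_cases hz : β = ν
    · simp [hz]
    · have p1 : 0 < β - ν * s₁ := by
        rcases hc1.eq_or_lt with h | h
        · exfalso; apply hz
          have := hb1 h.symm
          have e : s₁ = 1 := by linarith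
          rw [e] at h; linarith
        · exact h
      have p2 : 0 < β - ν * s₂ := by
        rcases hc2.eq_or_lt with h | h
        · exfalso; apply hz
          have := hb2 h.symm
          have e : s₂ = 1 := by linarith
          rw [e] at h; linarith
        · exact h
      apply mul_le_mul_of_nonneg_left _ (by positivity)
      rw [hs]
      exact auxB β ν s₁ s₂ t hβ hν ht ht1 h1 h2 p1 p2
  have i3 := mul_le_mul_of_nonneg_left i1 (show 0 ≤ (1 - β) ^ 2 / (4 * β) by positivity)
  linarith

/-- a product of nonnegative concave functions is quasi-concave. -/
lemma auxQC (u₁ u₂ k₁ k₂ t k m : ℝ) (ht : 0 ≤ t) (ht1 : t ≤ 1) (hu1 : 0 ≤ u₁) (hu2 : 0 ≤ u₂)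
    (hk1 : 0 ≤ k₁) (hk2 : 0 ≤ k₂) (hk : t * k₁ + (1 - t) * k₂ ≤ k)
    (hm1 : m ≤ u₁ ^ 2 * k₁) (hm2 : m ≤ u₂ ^ 2 * k₂) :
    m ≤ (t * u₁ + (1 - t) * u₂) ^ 2 * k := by
  have ht' := sub_nonneg.2 ht1
  rcases le_or_gt m 0 with hm | hm
  · refine hm.trans ?_
    have : 0 ≤ k := le_trans (by positivity) hk
    positivity
  have a1 := Real.geom_mean_le_arith_mean2_weighted ht ht' hu1 hu2 (by ring)
  have a2 := (Real.geom_mean_le_arith_mean2_weighted ht ht' hk1 hk2 (by ring)).trans hk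
  have b1 : m = m ^ t * m ^ (1 - t) := by
    rw [← Real.rpow_add hm]; simp
  have c1 := Real.rpow_le_rpow hm.le hm1 ht
  have c2 := Real.rpow_le_rpow hm.le hm2 ht'
  have d1 := mul_le_mul c1 c2 (by positivity) (by positivity)
  rw [← b1, Real.mul_rpow (by positivity) hk1, Real.mul_rpow (by positivity) hk2] at d1
  have e1 : (u₁ ^ 2) ^ t = (u₁ ^ t) ^ 2 := by
    rw [← Real.rpow_natCast, ← Real.rpow_natCast, ← Real.rpow_mul hu1, ← Real.rpow_mul hu1, mul_comm]
  have e2 : (u₂ ^ 2) ^ (1 - t) = (u₂ ^ (1 - t)) ^ 2 := by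
    rw [← Real.rpow_natCast, ← Real.rpow_natCast, ← Real.rpow_mul hu2, ← Real.rpow_mul hu2, mul_comm]
  rw [e1, e2] at d1
  calc m ≤ _ := d1
    _ = (u₁ ^ t * u₂ ^ (1 - t)) ^ 2 * (k₁ ^ t * k₂ ^ (1 - t)) := by ring
    _ ≤ _ := by gcongr

/-- quasi-concavity along the interior formula; here `s = αλ`. -/
lemma auxG (β ν s₁ s₂ s m : ℝ) (hβ : 0 ≤ β) (hν : 0 ≤ ν)
    (h1 : 0 < s₁) (h1s : s₁ ≤ s) (hs2 : s ≤ s₂)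
    (hc1 : 0 ≤ β - ν * s₁) (hc2 : 0 ≤ β - ν * s₂)
    (hb1 : β - ν * s₁ = 0 → s₁ - 1 - (β - ν * s₁) = 0)
    (hb2 : β - ν * s₂ = 0 → s₂ - 1 - (β - ν * s₂) = 0)
    (hc : 0 < β - ν * s)
    (hu1 : β - ν * s₁ ≤ 1) (hu2 : β - ν * s₂ ≤ 1)
    (hq1 : 0 ≤ 1 - (s₁ - 1 - (β - ν * s₁)) ^ 2 / (4 * (β - ν * s₁)))
    (hq2 : 0 ≤ 1 - (s₂ - 1 - (β - ν * s₂)) ^ 2 / (4 * (β - ν * s₂)))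
    (hm1 : m ≤ (1 - (β - ν * s₁)) ^ 2 *
      ((1 - (s₁ - 1 - (β - ν * s₁)) ^ 2 / (4 * (β - ν * s₁))) / s₁))
    (hm2 : m ≤ (1 - (β - ν * s₂)) ^ 2 *
      ((1 - (s₂ - 1 - (β - ν * s₂)) ^ 2 / (4 * (β - ν * s₂))) / s₂)) :
    m ≤ (1 - (β - ν * s)) ^ 2 *
      ((1 - (s - 1 - (β - ν * s)) ^ 2 / (4 * (β - ν * s))) / s) := by
  have hβ' : 0 < β := by
    have := mul_nonneg hν (h1.le.trans h1s)
    linarith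
  rcases (h1s.trans hs2).eq_or_lt with h | h
  · have : s = s₁ := by linarith
    rw [this]; exact hm1
  set t := (s₂ - s) / (s₂ - s₁) with htd
  have hd : 0 < s₂ - s₁ := by linarith
  have ht : 0 ≤ t := div_nonneg (by linarith) hd.le
  have ht1 : t ≤ 1 := by rw [htd, div_le_one hd]; linarith
  have hs : s = t * s₁ + (1 - t) * s₂ := by rw [htd]; field_simp; ring
  have e : 1 - (β - ν * s) = t * (1 - (β - ν * s₁)) + (1 - t) * (1 - (β - ν * s₂)) := by
    rw [hs]; ring
  have := auxConc β ν s₁ s₂ t hβ' hν ht ht1 h1 (h1.trans h) hc1 hc2 hb1 hb2 s hs hc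
  rw [show (1 - (β - ν * s)) ^ 2 = (t * (1 - (β - ν * s₁)) + (1 - t) * (1 - (β - ν * s₂))) ^ 2 by
    rw [e]]
  exact auxQC _ _ _ _ t _ m ht ht1 (by linarith) (by linarith)
    (div_nonneg hq1 h1.le) (div_nonneg hq2 (h1.trans h).le) this hm1 hm2

/-- Stability region of the scalar polynomial. -/
def Stab (α β ν lam : ℝ) : Prop :=
  cCoef α β ν lam < 1 ∧ |bCoef α β ν lam| < 1 + cCoef α β ν lam

lemma aux_q (b c : ℝ) (hc : 0 ≤ c) (hc1 : c < 1) (h : |b| * (1 + c) ≤ 4 * c) :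
    0 ≤ 1 - b ^ 2 / (4 * c) := by
  rcases hc.eq_or_lt with h0 | h0
  · subst h0; simp
  · rw [sub_nonneg, div_le_one (by linarith)]
    have h1 : (|b| * (1 + c)) ^ 2 ≤ (4 * c) ^ 2 := by gcongr
    rw [mul_pow, sq_abs] at h1
    have h2 : 4 * c * (b ^ 2) ≤ b ^ 2 * (1 + c) ^ 2 := by nlinarith [mul_nonneg (sq_nonneg b) (sq_nonneg (1 - c))]
    have h3 : 4 * c * b ^ 2 ≤ 4 * c * (4 * c) := by nlinarith
    exact le_of_mul_le_mul_left h3 (by linarith)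

lemma rCoef_nonneg (α β ν lam : ℝ) : 0 ≤ rCoef α β ν lam := by
  unfold rCoef; split_ifs <;> positivity

lemma rCoef_sq_int {α β ν lam : ℝ} (hS : Stab α β ν lam)
    (hc : 0 < cCoef α β ν lam)
    (h : |bCoef α β ν lam| * (1 + cCoef α β ν lam) < 4 * cCoef α β ν lam) :
    rCoef α β ν lam ^ 2 = (1 - cCoef α β ν lam) ^ 2 *
      (1 - bCoef α β ν lam ^ 2 / (4 * cCoef α β ν lam)) := by
  unfold rCoef
  rw [if_pos ⟨hc, by rw [div_lt_one (by linarith)]; exact h⟩, mul_pow, sq_abs, Real.sq_sqrt]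
  exact aux_q _ _ hc.le hS.1 h.le

lemma rCoef_sq_ext {α β ν lam : ℝ} (hS : Stab α β ν lam)
    (h : 4 * cCoef α β ν lam ≤ |bCoef α β ν lam| * (1 + cCoef α β ν lam)) :
    rCoef α β ν lam ^ 2 = (1 + cCoef α β ν lam - |bCoef α β ν lam|) ^ 2 := by
  unfold rCoef
  have h0 := abs_nonneg (bCoef α β ν lam)
  have h1 := hS.2
  rw [if_neg, sq_abs, abs_of_pos (by linarith : 0 < 1 + cCoef α β ν lam)]
  rintro ⟨hc, h2⟩
  rw [div_lt_one (by linarith)] at h2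
  linarith

lemma rCoef_cases {α β ν lam : ℝ} (hS : Stab α β ν lam) :
    (0 < cCoef α β ν lam ∧ |bCoef α β ν lam| * (1 + cCoef α β ν lam) < 4 * cCoef α β ν lam) ∨
    4 * cCoef α β ν lam ≤ |bCoef α β ν lam| * (1 + cCoef α β ν lam) := by
  rcases le_or_gt (4 * cCoef α β ν lam) (|bCoef α β ν lam| * (1 + cCoef α β ν lam)) with h | h
  · exact Or.inr h
  · left
    refine ⟨?_, h⟩
    have h0 := abs_nonneg (bCoef α β ν lam)
    have h1 := hS.2
    have : 0 ≤ |bCoef α β ν lam| * (1 + cCoef α β ν lam) := mul_nonneg h0 (by linarith)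
    linarith

/-- `|p(e^{iθ})|²` as a function of `x = cos θ`. -/
noncomputable def fF (b c x : ℝ) : ℝ := 4 * c * x ^ 2 + 2 * b * (1 + c) * x + b ^ 2 + (1 - c) ^ 2

lemma rCoef_le {α β ν lam : ℝ} (hS : Stab α β ν lam) (x : ℝ) (hx : |x| ≤ 1) :
    rCoef α β ν lam ^ 2 ≤ fF (bCoef α β ν lam) (cCoef α β ν lam) x := by
  rcases rCoef_cases hS with ⟨hc, h⟩ | h
  · rw [rCoef_sq_int hS hc h]
    unfold fF
    set b := bCoef α β ν lam
    set c := cCoef α β ν lam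
    have : 4 * c * x ^ 2 + 2 * b * (1 + c) * x + b ^ 2 + (1 - c) ^ 2 -
      (1 - c) ^ 2 * (1 - b ^ 2 / (4 * c)) = 4 * c * (x + b * (1 + c) / (4 * c)) ^ 2 := by
      field_simp; ring
    have : 0 ≤ 4 * c * (x + b * (1 + c) / (4 * c)) ^ 2 := by positivity
    linarith
  · rw [rCoef_sq_ext hS h]
    unfold fF
    have h2 := hS.2
    set b := bCoef α β ν lam
    set c := cCoef α β ν lam
    have h0 := abs_nonneg b
    have hy := abs_nonneg x
    have e1 : -(|b| * |x|) ≤ b * x := by rw [← abs_mul]; exact neg_abs_le _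
    have e2 : 0 ≤ (1 - |x|) * (2 * |b| * (1 + c) - 4 * c * (1 + |x|)) := by
      apply mul_nonneg (by linarith)
      rcases le_or_gt c 0 with h3 | h3
      · have : 0 ≤ |b| * (1 + c) := mul_nonneg h0 (by linarith)
        nlinarith
      · nlinarith
    have e3 := mul_le_mul_of_nonneg_left e1 (show 0 ≤ 2 * (1 + c) by linarith)
    have e4 := sq_abs x
    have e5 := sq_abs b
    nlinarith

lemma rCoef_attained {α β ν lam : ℝ} (hS : Stab α β ν lam) :
    ∃ x : ℝ, |x| ≤ 1 ∧ rCoef α β ν lam ^ 2 = fF (bCoef α β ν lam) (cCoef α β ν lam) x := by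
  rcases rCoef_cases hS with ⟨hc, h⟩ | h
  · rw [rCoef_sq_int hS hc h]
    have h2 := hS.2
    unfold fF
    set b := bCoef α β ν lam
    set c := cCoef α β ν lam
    refine ⟨-(b * (1 + c) / (4 * c)), ?_, ?_⟩
    · rw [abs_neg, abs_div, abs_mul, abs_of_pos (by linarith : 0 < 1 + c),
        abs_of_pos (by linarith : 0 < 4 * c), div_le_one (by linarith)]
      exact h.le
    · field_simp; ring
  · rw [rCoef_sq_ext hS h]
    unfold fF
    set b := bCoef α β ν lam
    set c := cCoef α β ν lam
    rcases le_total b 0 with hb | hb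
    · exact ⟨1, by simp, by rw [abs_of_nonpos hb]; ring⟩
    · exact ⟨-1, by simp, by rw [abs_of_nonneg hb]; ring⟩

lemma fF_pos (b c x : ℝ) (hc : c < 1) (hb : |b| < 1 + c) (hx : |x| ≤ 1) : 0 < fF b c x := by
  have e : fF b c x = ((1 + c) * x + b) ^ 2 + (1 - c) ^ 2 * (1 - x ^ 2) := by unfold fF; ring
  rw [e]
  have hx2 : x ^ 2 ≤ 1 := by rw [← sq_abs]; nlinarith [abs_nonneg x]
  rw [abs_lt] at hb
  rcases hx2.eq_or_lt with h | h
  · have : x = 1 ∨ x = -1 := mul_self_eq_one_iff.1 (by rw [← sq]; exact h)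
    rcases this with rfl | rfl
    · have : 0 < (1 + c) * 1 + b := by linarith
      nlinarith [sq_pos_of_pos this]
    · have : 0 < -((1 + c) * -1 + b) := by linarith
      nlinarith [sq_pos_of_pos this]
  · have : 0 < (1 - c) ^ 2 * (1 - x ^ 2) := mul_pos (pow_pos (by linarith) 2) (by linarith)
    positivity

lemma rCoef_pos {α β ν lam : ℝ} (hS : Stab α β ν lam) : 0 < rCoef α β ν lam := by
  obtain ⟨x, hx, h⟩ := rCoef_attained hS
  have := fF_pos _ _ x hS.1 hS.2 hx
  rw [← h] at this
  exact lt_of_le_of_ne' (rCoef_nonneg _ _ _ _) (fun h0 => by simp [h0] at this)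

lemma Stab_between {α β ν l₁ l₂ l : ℝ} (h1 : Stab α β ν l₁) (h2 : Stab α β ν l₂)
    (hl1 : l₁ ≤ l) (hl2 : l ≤ l₂) : Stab α β ν l := by
  rcases (hl1.trans hl2).eq_or_lt with h | h
  · have : l = l₁ := by linarith
    rw [this]; exact h1
  have hd : 0 < l₂ - l₁ := by linarith
  set t := (l₂ - l) / (l₂ - l₁) with htd
  have ht : 0 ≤ t := div_nonneg (by linarith) hd.le
  have ht1 : t ≤ 1 := by rw [htd, div_le_one hd]; linarith
  have hs : l = t * l₁ + (1 - t) * l₂ := by rw [htd]; field_simp; ring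
  have eb : bCoef α β ν l = t * bCoef α β ν l₁ + (1 - t) * bCoef α β ν l₂ := by
    unfold bCoef; rw [hs]; ring
  have ec : cCoef α β ν l = t * cCoef α β ν l₁ + (1 - t) * cCoef α β ν l₂ := by
    unfold cCoef; rw [hs]; ring
  have conv : ∀ a b : ℝ, 0 < a → 0 < b → 0 < t * a + (1 - t) * b := by
    intro a b ha hb
    rcases ht.eq_or_lt with h | h
    · rw [← h]; linarith
    · have := mul_pos h ha
      have := mul_nonneg (sub_nonneg.2 ht1) hb.le
      linarith
  unfold Stab at *
  rw [abs_lt] at *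
  have k1 := conv _ _ (sub_pos.2 h1.1) (sub_pos.2 h2.1)
  have k2 := conv _ _ (sub_pos.2 h1.2.1) (sub_pos.2 h2.2.1)
  have k3 := conv _ _ (sub_pos.2 h1.2.2) (sub_pos.2 h2.2.2)
  rw [eb, ec]
  refine ⟨?_, ?_, ?_⟩ <;> nlinarith

/-- endpoint bound -/
lemma end_bound {α β ν l₁ l₂ l m : ℝ} (hα : 0 < α) (hν : 0 ≤ ν) (hl : 0 < l₁)
    (h1 : Stab α β ν l₁) (h2 : Stab α β ν l₂)
    (hl1 : l₁ ≤ l) (hl2 : l ≤ l₂)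
    (hm1 : m ≤ rCoef α β ν l₁ ^ 2 / (α * l₁)) (hm2 : m ≤ rCoef α β ν l₂ ^ 2 / (α * l₂)) :
    m ≤ (1 + cCoef α β ν l - |bCoef α β ν l|) ^ 2 / (α * l) := by
  have hlp : 0 < l := by linarith
  have hl2p : 0 < l₂ := by linarith
  rcases le_total (bCoef α β ν l) 0 with hb | hb
  · have e : 1 + cCoef α β ν l - |bCoef α β ν l| = α * l := by
      rw [abs_of_nonpos hb]; unfold cCoef bCoef; ring
    rw [e]
    have k := rCoef_le h1 1 (by simp)
    have e2 : fF (bCoef α β ν l₁) (cCoef α β ν l₁) 1 = (α * l₁) ^ 2 := by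
      unfold fF cCoef bCoef; ring
    rw [e2] at k
    calc m ≤ _ := hm1
      _ ≤ (α * l₁) ^ 2 / (α * l₁) := by gcongr
      _ = α * l₁ := by field_simp
      _ ≤ α * l := by gcongr
      _ = _ := by field_simp
  · rw [abs_of_nonneg hb]
    have k := rCoef_le h2 (-1) (by simp)
    have e2 : fF (bCoef α β ν l₂) (cCoef α β ν l₂) (-1)
        = (1 + cCoef α β ν l₂ - bCoef α β ν l₂) ^ 2 := by
      unfold fF; ring
    rw [e2] at k
    have p : 0 ≤ 1 + cCoef α β ν l₂ - bCoef α β ν l₂ := by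
      have := h2.2; have := le_abs_self (bCoef α β ν l₂); linarith
    have q : 1 + cCoef α β ν l₂ - bCoef α β ν l₂ ≤ 1 + cCoef α β ν l - bCoef α β ν l := by
      have : 0 ≤ (l₂ - l) * (α * (1 + 2 * ν)) := mul_nonneg (by linarith) (by positivity)
      unfold cCoef bCoef; nlinarith
    calc m ≤ _ := hm2
      _ ≤ (1 + cCoef α β ν l₂ - bCoef α β ν l₂) ^ 2 / (α * l₂) := by gcongr
      _ ≤ _ := by gcongr

lemma g_zero (b c : ℝ) (hc : 0 ≤ c) (h : |b| * (1 + c) = 4 * c) :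
    (1 - c) ^ 2 * (1 - b ^ 2 / (4 * c)) = (1 + c - |b|) ^ 2 := by
  have hb : |b| = 4 * c / (1 + c) := by rw [← h]; field_simp
  rw [← sq_abs b, hb]
  rcases hc.eq_or_lt with h0 | h0
  · rw [← h0]; simp
  · field_simp; ring

lemma qc {α β ν l₁ l₂ l m : ℝ} (hα : 0 < α) (hβ : 0 ≤ β) (hν : 0 ≤ ν) (hl : 0 < l₁)
    (h1 : Stab α β ν l₁) (h2 : Stab α β ν l₂)
    (hl1 : l₁ ≤ l) (hl2 : l ≤ l₂)
    (hm1 : m ≤ rCoef α β ν l₁ ^ 2 / (α * l₁)) (hm2 : m ≤ rCoef α β ν l₂ ^ 2 / (α * l₂)) :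
    m ≤ rCoef α β ν l ^ 2 / (α * l) := by
  have hS := Stab_between h1 h2 hl1 hl2
  rcases rCoef_cases hS with ⟨hc, h⟩ | h
  swap
  · rw [rCoef_sq_ext hS h]
    exact end_bound hα hν hl h1 h2 hl1 hl2 hm1 hm2
  set φ : ℝ → ℝ := fun y => 4 * cCoef α β ν y - |bCoef α β ν y| * (1 + cCoef α β ν y) with hφ
  have hcont : Continuous φ := by
    rw [hφ]; unfold cCoef bCoef; fun_prop
  have zero_good : ∀ y, l₁ ≤ y → y ≤ l₂ → φ y = 0 → 0 ≤ cCoef α β ν y ∧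
      |bCoef α β ν y| * (1 + cCoef α β ν y) ≤ 4 * cCoef α β ν y ∧
      m ≤ (1 - cCoef α β ν y) ^ 2 * (1 - bCoef α β ν y ^ 2 / (4 * cCoef α β ν y)) / (α * y) := by
    intro y hy1 hy2 hy
    have hSy := Stab_between h1 h2 hy1 hy2
    have e : |bCoef α β ν y| * (1 + cCoef α β ν y) = 4 * cCoef α β ν y := by
      simp only [hφ] at hy; linarith
    have h0 := abs_nonneg (bCoef α β ν y)
    have hc0 : 0 ≤ cCoef α β ν y := by
      have := hSy.2
      have := mul_nonneg h0 (by linarith : 0 ≤ 1 + cCoef α β ν y)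
      linarith
    refine ⟨hc0, e.le, ?_⟩
    rw [g_zero _ _ hc0 e]
    exact end_bound hα hν hl h1 h2 hy1 hy2 hm1 hm2
  have left : ∃ y, l₁ ≤ y ∧ y ≤ l ∧ 0 ≤ cCoef α β ν y ∧
      |bCoef α β ν y| * (1 + cCoef α β ν y) ≤ 4 * cCoef α β ν y ∧
      m ≤ (1 - cCoef α β ν y) ^ 2 * (1 - bCoef α β ν y ^ 2 / (4 * cCoef α β ν y)) / (α * y) := by
    rcases rCoef_cases h1 with ⟨hc', h'⟩ | h'
    · exact ⟨l₁, le_rfl, hl1, hc'.le, h'.le, by rw [← rCoef_sq_int h1 hc' h']; exact hm1⟩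
    · have := intermediate_value_Icc hl1 hcont.continuousOn
      obtain ⟨y, ⟨hy1, hy2⟩, hy⟩ := this (show (0 : ℝ) ∈ Set.Icc (φ l₁) (φ l) from
        ⟨by simp only [hφ]; linarith, by simp only [hφ]; linarith⟩)
      exact ⟨y, hy1, hy2, zero_good y hy1 (hy2.trans hl2) hy⟩
  have right : ∃ y, l ≤ y ∧ y ≤ l₂ ∧ 0 ≤ cCoef α β ν y ∧
      |bCoef α β ν y| * (1 + cCoef α β ν y) ≤ 4 * cCoef α β ν y ∧
      m ≤ (1 - cCoef α β ν y) ^ 2 * (1 - bCoef α β ν y ^ 2 / (4 * cCoef α β ν y)) / (α * y) := by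
    rcases rCoef_cases h2 with ⟨hc', h'⟩ | h'
    · exact ⟨l₂, hl2, le_rfl, hc'.le, h'.le, by rw [← rCoef_sq_int h2 hc' h']; exact hm2⟩
    · have := intermediate_value_Icc' hl2 hcont.continuousOn
      obtain ⟨y, ⟨hy1, hy2⟩, hy⟩ := this (show (0 : ℝ) ∈ Set.Icc (φ l₂) (φ l) from
        ⟨by simp only [hφ]; linarith, by simp only [hφ]; linarith⟩)
      exact ⟨y, hy1, hy2, zero_good y (hl1.trans hy1) hy2 hy⟩
  obtain ⟨y, hy1, hyl, hcy, hby, hmy⟩ := left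
  obtain ⟨w, hlw, hw2, hcw, hbw, hmw⟩ := right
  have hSy := Stab_between h1 h2 hy1 (hyl.trans hl2)
  have hSw := Stab_between h1 h2 (hl1.trans hlw) hw2
  have ec : ∀ y, cCoef α β ν y = β - ν * (α * y) := fun y => by unfold cCoef; ring
  have eb : ∀ y, bCoef α β ν y = α * y - 1 - (β - ν * (α * y)) := fun y => by unfold bCoef; ring
  have z : ∀ y, |bCoef α β ν y| * (1 + cCoef α β ν y) ≤ 4 * cCoef α β ν y →
      cCoef α β ν y = 0 → bCoef α β ν y = 0 := by
    intro y hy h0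
    rw [h0] at hy
    simpa using hy
  rw [rCoef_sq_int hS hc h, mul_div_assoc, ec, eb]
  rw [mul_div_assoc] at hmy hmw
  have hqy := aux_q _ _ hcy hSy.1 hby
  have hqw := aux_q _ _ hcw hSw.1 hbw
  have zy := z y hby
  have zw := z w hbw
  have uy := hSy.1.le
  have uw := hSw.1.le
  simp only [ec, eb] at hmy hmw hqy hqw zy zw uy uw hcy hcw hc
  exact auxG β ν (α * y) (α * w) (α * l) m hβ hν (mul_pos hα (by linarith))
    (by gcongr) (by gcongr) hcy hcw zy zw hc uy uw hqy hqw hmy hmw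

lemma stab_of_roots (b c : ℝ) (h : ∀ z : ℂ, z ^ 2 + b * z + c = 0 → ‖z‖ < 1) (hp : 0 < 1 + c + b) :
    c < 1 ∧ |b| < 1 + c := by
  obtain ⟨w, hw⟩ := IsAlgClosed.exists_pow_nat_eq ((b : ℂ) ^ 2 - 4 * c) (n := 2) (by norm_num)
  have h1 := h ((-b + w) / 2) (by linear_combination hw / 4)
  have h2 := h ((-b - w) / 2) (by linear_combination hw / 4)
  have e : ((-b + w) / 2) * ((-b - w) / 2) = (c : ℂ) := by linear_combination -hw / 4
  have hc : |c| < 1 := by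
    have : ‖(c : ℂ)‖ < 1 := by
      rw [← e, norm_mul]
      nlinarith [norm_nonneg ((-b + w) / 2), norm_nonneg ((-b - w) / 2)]
    simpa using this
  rw [abs_lt] at hc
  refine ⟨hc.2, ?_⟩
  rw [abs_lt]
  refine ⟨by linarith, ?_⟩
  by_contra hb
  push Not at hb
  have hd : (1 - c) ^ 2 ≤ b ^ 2 - 4 * c := by nlinarith
  have hs := Real.le_sqrt_of_sq_le hd
  have hsq := Real.sq_sqrt (le_trans (sq_nonneg _) hd)
  set s := √(b ^ 2 - 4 * c)
  have h3 := h (((-b - s) / 2 : ℝ) : ℂ) (by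
    norm_cast
    linear_combination hsq / 4)
  rw [Complex.norm_real, Real.norm_eq_abs, abs_lt] at h3
  linarith

lemma p_normSq (b c : ℝ) (z : ℂ) (R x : ℝ) (hR : R ^ 2 = z.re ^ 2 + z.im ^ 2) (hx : z.re = R * x) :
    ‖z ^ 2 + b * z + c‖ ^ 2 = R ^ 2 * fF b c x +
      (R - 1) * (R - c) * (R ^ 2 + c + R * (1 + c) + 2 * b * x * R) := by
  rw [← Complex.normSq_eq_norm_sq, Complex.normSq_apply]
  have e1 : (z ^ 2 + b * z + c).re = z.re ^ 2 - z.im ^ 2 + b * z.re + c := by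
    simp [sq]
  have e2 : (z ^ 2 + b * z + c).im = 2 * z.re * z.im + b * z.im := by
    simp [sq]; ring
  rw [e1, e2]
  have him : z.im ^ 2 = R ^ 2 - R ^ 2 * x ^ 2 := by rw [hx] at hR; linarith
  have e3 : (z.re ^ 2 - z.im ^ 2 + b * z.re + c) * (z.re ^ 2 - z.im ^ 2 + b * z.re + c) +
    (2 * z.re * z.im + b * z.im) * (2 * z.re * z.im + b * z.im)
    = (z.re ^ 2 - z.im ^ 2 + b * z.re + c) ^ 2 + (2 * z.re + b) ^ 2 * z.im ^ 2 := by ring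
  rw [e3, him, hx]; unfold fF; ring

lemma p_lower {α β ν lam : ℝ} (hS : Stab α β ν lam) (z : ℂ) (hz : 1 ≤ ‖z‖) :
    rCoef α β ν lam * ‖z‖ ≤ ‖z ^ 2 + bCoef α β ν lam * z + cCoef α β ν lam‖ := by
  have hx : |z.re / ‖z‖| ≤ 1 := by
    rw [abs_div, abs_norm, div_le_one (by linarith)]; exact Complex.abs_re_le_norm z
  have hxx : z.re = ‖z‖ * (z.re / ‖z‖) := by field_simp
  have hR : ‖z‖ ^ 2 = z.re ^ 2 + z.im ^ 2 := by
    rw [← Complex.normSq_eq_norm_sq, Complex.normSq_apply]; ring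
  have k := p_normSq (bCoef α β ν lam) (cCoef α β ν lam) z ‖z‖ _ hR hxx
  have k2 := rCoef_le hS _ hx
  obtain ⟨h1, h2⟩ := hS
  set b := bCoef α β ν lam
  set c := cCoef α β ν lam
  set x := z.re / ‖z‖
  set R := ‖z‖
  have hbx : -(1 + c) ≤ b * x := by
    have : |b * x| ≤ 1 + c := by
      rw [abs_mul]; nlinarith [abs_nonneg b, abs_nonneg x]
    exact (abs_le.1 this).1
  have f1 : 0 ≤ (R - 1) * (R - c) := mul_nonneg (by linarith) (by linarith)
  have f2 : 0 ≤ R ^ 2 + c + R * (1 + c) + 2 * b * x * R := by nlinarith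
  have f3 := mul_nonneg f1 f2
  rw [← sq_le_sq₀ (mul_nonneg (rCoef_nonneg _ _ _ _) (by linarith)) (norm_nonneg _), k, mul_pow]
  nlinarith [mul_le_mul_of_nonneg_left k2 (sq_nonneg R)]

lemma p_attained {α β ν lam : ℝ} (hS : Stab α β ν lam) :
    ∃ z : ℂ, ‖z‖ = 1 ∧
      ‖z ^ 2 + bCoef α β ν lam * z + cCoef α β ν lam‖ = rCoef α β ν lam := by
  obtain ⟨x, hx, h⟩ := rCoef_attained hS
  have hx2 : 0 ≤ 1 - x ^ 2 := by
    rw [← sq_abs]; nlinarith [abs_nonneg x]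
  have hs := Real.sq_sqrt hx2
  refine ⟨⟨x, √(1 - x ^ 2)⟩, ?_, ?_⟩
  · have : ‖(⟨x, √(1 - x ^ 2)⟩ : ℂ)‖ ^ 2 = 1 := by
      rw [← Complex.normSq_eq_norm_sq, Complex.normSq_apply]; simp only; linarith
    exact (pow_eq_one_iff_of_nonneg (norm_nonneg _) two_ne_zero).1 this
  · have k := p_normSq (bCoef α β ν lam) (cCoef α β ν lam) ⟨x, √(1 - x ^ 2)⟩ 1 x
      (by simp only; linarith) (by simp)
    rw [← pow_left_inj₀ (norm_nonneg _) (rCoef_nonneg _ _ _ _) two_ne_zero, k, h]; ring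

lemma mem_spec_iff {n : Type*} [Fintype n] [DecidableEq n] (M : Matrix n n ℂ) (z : ℂ) :
    z ∈ spectrum ℂ M ↔ ∃ v ≠ 0, M *ᵥ v = z • v := by
  rw [spectrum.mem_iff, Matrix.isUnit_iff_isUnit_det, isUnit_iff_ne_zero, not_not,
    ← Matrix.exists_mulVec_eq_zero_iff]
  constructor <;> rintro ⟨v, hv, h⟩ <;> refine ⟨v, hv, ?_⟩
  · rw [Matrix.sub_mulVec, sub_eq_zero, Algebra.algebraMap_eq_smul_one, Matrix.smul_mulVec,
      Matrix.one_mulVec] at h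
    exact h.symm
  · rw [Matrix.sub_mulVec, sub_eq_zero, Algebra.algebraMap_eq_smul_one, Matrix.smul_mulVec,
      Matrix.one_mulVec]
    exact h.symm

section mat
variable {d : ℕ} (α β ν : ℝ) (lam : Fin d → ℝ) (U Q : Matrix (Fin d) (Fin d) ℝ)

lemma map_U (hU : U * Uᵀ = 1) :
    (U.map Complex.ofReal)ᵀ * (U.map Complex.ofReal) = 1 ∧
    (U.map Complex.ofReal) * (U.map Complex.ofReal)ᵀ = 1 := by
  have h : (U.map Complex.ofReal) * (U.map Complex.ofReal)ᵀ = 1 := by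
    have := congrArg (fun M => M.map Complex.ofRealHom) hU
    have h' : U.map Complex.ofRealHom * (U.map Complex.ofRealHom)ᵀ = 1 := by
      simpa [Matrix.map_mul, Matrix.transpose_map] using this
    exact h'
  exact ⟨mul_eq_one_comm.1 h, h⟩

lemma mulVec_M (hU : U * Uᵀ = 1) (hQ : Q = U * Matrix.diagonal lam * Uᵀ)
    (Δ : Matrix (Fin d) (Fin d) ℂ) (a w : Fin d → ℂ) :
    (AQc α β ν Q + Bc (d := d) α * Δ * Tc lam U) *ᵥ
      Sum.elim ((U.map Complex.ofReal) *ᵥ a) ((U.map Complex.ofReal) *ᵥ w) =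
    Sum.elim ((U.map Complex.ofReal) *ᵥ (fun j => -(bCoef α β ν (lam j) : ℂ) * a j
        - (cCoef α β ν (lam j) : ℂ) * w j)
        - (((α / √2 : ℝ) : ℂ)) • (Δ *ᵥ fun j => ((√(lam j) : ℝ) : ℂ) * a j))
      ((U.map Complex.ofReal) *ᵥ a) := by
  obtain ⟨h1, h2⟩ := map_U U hU
  have hQc : Q.map Complex.ofReal = (U.map Complex.ofReal) *
      Matrix.diagonal (fun j => (lam j : ℂ)) * (U.map Complex.ofReal)ᵀ := by
    have := congrArg (fun M => M.map Complex.ofRealHom) hQ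
    have h' : Q.map Complex.ofRealHom = (U.map Complex.ofRealHom) *
      Matrix.diagonal (fun j => (lam j : ℂ)) * (U.map Complex.ofRealHom)ᵀ := by
      simpa [Matrix.map_mul, Matrix.transpose_map, Matrix.diagonal_map] using this
    exact h'
  set V := U.map Complex.ofReal
  have hQV : ∀ a : Fin d → ℂ, Q.map Complex.ofReal *ᵥ (V *ᵥ a) = V *ᵥ (fun j => (lam j : ℂ) * a j) := by
    intro a
    rw [hQc, Matrix.mulVec_mulVec, Matrix.mul_assoc, h1, Matrix.mul_one, ← Matrix.mulVec_mulVec]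
    congr 1
    ext j
    rw [Matrix.mulVec_diagonal]
  have hTV : ∀ a y : Fin d → ℂ, Tc lam U *ᵥ Sum.elim (V *ᵥ a) y
      = ((1 / √2 : ℝ) : ℂ) • fun j => ((√(lam j) : ℝ) : ℂ) * a j := by
    intro a y
    unfold Tc
    rw [Matrix.smul_mulVec, Matrix.fromCols_mulVec]
    congr 1
    simp only [Sum.elim_comp_inl, Sum.elim_comp_inr, Matrix.zero_mulVec, add_zero]
    rw [Matrix.mulVec_mulVec, Matrix.mul_assoc, h1, Matrix.mul_one]
    ext j
    rw [Matrix.mulVec_diagonal]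
  rw [Matrix.add_mulVec, ← Matrix.mulVec_mulVec, hTV, ← Matrix.mulVec_mulVec]
  unfold AQc Bc
  rw [Matrix.fromBlocks_mulVec, Matrix.fromRows_mulVec]
  simp only [Sum.elim_comp_inl, Sum.elim_comp_inr, Matrix.zero_mulVec, add_zero,
    Matrix.one_mulVec, Matrix.sub_mulVec, Matrix.add_mulVec, Matrix.smul_mulVec, hQV]
  have e : (fun j => -(bCoef α β ν (lam j) : ℂ) * a j - (cCoef α β ν (lam j) : ℂ) * w j) =
      (1 + β : ℂ) • a - ((α * (1 + ν) : ℝ) : ℂ) • (fun j => (lam j : ℂ) * a j) +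
      ((-(β : ℂ)) • w + ((α * ν : ℝ) : ℂ) • fun j => (lam j : ℂ) * w j) := by
    ext j
    simp only [bCoef, cCoef, Pi.add_apply, Pi.sub_apply, Pi.smul_apply, smul_eq_mul]
    push_cast
    ring
  rw [e]
  simp only [Matrix.mulVec_add, Matrix.mulVec_sub, Matrix.mulVec_smul]
  ext i
  rcases i with i | i
  · simp only [Pi.add_apply, Sum.elim_inl, Pi.sub_apply, Pi.smul_apply, smul_eq_mul]
    push_cast
    ring
  · simp

lemma spec_iff (hU : U * Uᵀ = 1) (hQ : Q = U * Matrix.diagonal lam * Uᵀ)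
    (Δ : Matrix (Fin d) (Fin d) ℂ) (z : ℂ) :
    z ∈ spectrum ℂ (AQc α β ν Q + Bc (d := d) α * Δ * Tc lam U) ↔
    ∃ w : Fin d → ℂ, w ≠ 0 ∧ (U.map Complex.ofReal) *ᵥ
      (fun j => (z ^ 2 + bCoef α β ν (lam j) * z + cCoef α β ν (lam j)) * w j) =
      (-(((α / √2 : ℝ) : ℂ) * z)) • (Δ *ᵥ fun j => ((√(lam j) : ℝ) : ℂ) * w j) := by
  obtain ⟨h1, h2⟩ := map_U U hU
  have key : ∀ w : Fin d → ℂ,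
      ((AQc α β ν Q + Bc (d := d) α * Δ * Tc lam U) *ᵥ
      Sum.elim ((U.map Complex.ofReal) *ᵥ (z • w)) ((U.map Complex.ofReal) *ᵥ w) =
      z • Sum.elim ((U.map Complex.ofReal) *ᵥ (z • w)) ((U.map Complex.ofReal) *ᵥ w)) ↔
      (U.map Complex.ofReal) *ᵥ
      (fun j => (z ^ 2 + bCoef α β ν (lam j) * z + cCoef α β ν (lam j)) * w j) =
      (-(((α / √2 : ℝ) : ℂ) * z)) • (Δ *ᵥ fun j => ((√(lam j) : ℝ) : ℂ) * w j) := by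
    intro w
    rw [mulVec_M α β ν lam U Q hU hQ]
    have e1 : (fun j => (z ^ 2 + bCoef α β ν (lam j) * z + cCoef α β ν (lam j)) * w j) =
      z • (z • w) - (fun j => -(bCoef α β ν (lam j) : ℂ) * (z • w) j
        - (cCoef α β ν (lam j) : ℂ) * w j) := by
      ext j; simp only [Pi.sub_apply, Pi.smul_apply, smul_eq_mul]; ring
    have e2 : (fun j => ((√(lam j) : ℝ) : ℂ) * (z • w) j) =
        z • fun j => ((√(lam j) : ℝ) : ℂ) * w j := by
      ext j; simp only [Pi.smul_apply, smul_eq_mul]; ring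
    rw [e1, e2, Matrix.mulVec_sub, Matrix.mulVec_smul _ z (z • w), Matrix.mulVec_smul _ z w,
      Matrix.mulVec_smul]
    constructor
    · intro h
      ext i
      have := congrFun h (Sum.inl i)
      simp only [Sum.elim_inl, Pi.sub_apply, Pi.smul_apply, smul_eq_mul] at this ⊢
      linear_combination -this
    · intro h
      ext i
      rcases i with i | i
      · have := congrFun h i
        simp only [Sum.elim_inl, Pi.sub_apply, Pi.smul_apply, smul_eq_mul] at this ⊢
        linear_combination -this
      · simp
  rw [mem_spec_iff]
  constructor
  · rintro ⟨v, hv, h⟩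
    set w := (U.map Complex.ofReal)ᵀ *ᵥ (v ∘ Sum.inr) with hw
    have hv2 : (U.map Complex.ofReal) *ᵥ w = v ∘ Sum.inr := by
      rw [hw, Matrix.mulVec_mulVec, h2, Matrix.one_mulVec]
    set a := (U.map Complex.ofReal)ᵀ *ᵥ (v ∘ Sum.inl) with ha
    have hv1 : (U.map Complex.ofReal) *ᵥ a = v ∘ Sum.inl := by
      rw [ha, Matrix.mulVec_mulVec, h2, Matrix.one_mulVec]
    have hvv : v = Sum.elim ((U.map Complex.ofReal) *ᵥ a) ((U.map Complex.ofReal) *ᵥ w) := by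
      rw [hv1, hv2]; simp
    have haw : a = z • w := by
      have h' := h
      rw [hvv, mulVec_M α β ν lam U Q hU hQ] at h'
      have : (U.map Complex.ofReal) *ᵥ a = (U.map Complex.ofReal) *ᵥ (z • w) := by
        rw [Matrix.mulVec_smul]
        ext i
        simpa using congrFun h' (Sum.inr i)
      have := congrArg (fun x => (U.map Complex.ofReal)ᵀ *ᵥ x) this
      simpa [Matrix.mulVec_mulVec, h1] using this
    refine ⟨w, ?_, ?_⟩
    · intro h0
      apply hv
      rw [hvv, haw, h0]
      ext i; rcases i <;> simp
    · rw [← key, ← haw, ← hvv]; exact h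
  · rintro ⟨w, hw, h⟩
    refine ⟨_, ?_, (key w).2 h⟩
    intro h0
    apply hw
    have : (U.map Complex.ofReal) *ᵥ w = 0 := by
      ext i; simpa using congrFun h0 (Sum.inr i)
    have := congrArg (fun x => (U.map Complex.ofReal)ᵀ *ᵥ x) this
    simpa [Matrix.mulVec_mulVec, h1] using this

end mat

lemma norm_map_le {d : ℕ} (Δ : Matrix (Fin d) (Fin d) ℝ) : ‖Δ.map Complex.ofReal‖ ≤ ‖Δ‖ := by
  rw [Matrix.cstar_norm_def]
  refine ContinuousLinearMap.opNorm_le_bound _ (norm_nonneg _) (fun v => ?_)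
  rw [← sq_le_sq₀ (norm_nonneg _) (by positivity), mul_pow]
  set x : EuclideanSpace ℝ (Fin d) := WithLp.toLp 2 (fun j => (v j).re) with hx
  set y : EuclideanSpace ℝ (Fin d) := WithLp.toLp 2 (fun j => (v j).im) with hy
  have e1 : ‖v‖ ^ 2 = ‖x‖ ^ 2 + ‖y‖ ^ 2 := by
    rw [EuclideanSpace.norm_sq_eq, EuclideanSpace.norm_sq_eq, EuclideanSpace.norm_sq_eq,
      ← Finset.sum_add_distrib]
    refine Finset.sum_congr rfl fun j _ => ?_
    rw [← Complex.normSq_eq_norm_sq, Complex.normSq_apply]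
    simp [hx, hy]; ring
  have e2 : ‖(toEuclideanCLM (n := Fin d) (𝕜 := ℂ) (Δ.map Complex.ofReal)) v‖ ^ 2
      = ‖WithLp.toLp 2 (Δ *ᵥ x)‖ ^ 2 + ‖WithLp.toLp 2 (Δ *ᵥ y)‖ ^ 2 := by
    rw [EuclideanSpace.norm_sq_eq, EuclideanSpace.norm_sq_eq, EuclideanSpace.norm_sq_eq,
      ← Finset.sum_add_distrib]
    refine Finset.sum_congr rfl fun j _ => ?_
    rw [← Complex.normSq_eq_norm_sq, Complex.normSq_apply, Matrix.ofLp_toEuclideanCLM]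
    simp [hx, hy, Matrix.mulVec, dotProduct]; ring
  have i1 := Matrix.l2_opNorm_mulVec Δ x
  have i2 := Matrix.l2_opNorm_mulVec Δ y
  have j1 := pow_le_pow_left₀ (norm_nonneg _) i1 2
  have j2 := pow_le_pow_left₀ (norm_nonneg _) i2 2
  rw [mul_pow] at j1 j2
  rw [e1, e2, mul_add]
  exact add_le_add j1 j2

lemma norm_V {d : ℕ} (U : Matrix (Fin d) (Fin d) ℝ) (hU : U * Uᵀ = 1) :
    ‖(U.map Complex.ofReal)ᵀ‖ ≤ 1 := by
  have h := (map_U U hU).2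
  have hc : ((U.map Complex.ofReal)ᵀ)ᴴ = U.map Complex.ofReal := by
    ext i j; simp
  have k := Matrix.l2_opNorm_conjTranspose_mul_self ((U.map Complex.ofReal)ᵀ)
  rw [hc, h] at k
  have h1 : ‖(1 : Matrix (Fin d) (Fin d) ℂ)‖ ≤ 1 := by
    rw [← Matrix.diagonal_one, Matrix.l2_opNorm_diagonal]
    exact (pi_norm_le_iff_of_nonneg zero_le_one).2 (fun i => by simp)
  nlinarith [norm_nonneg ((U.map Complex.ofReal)ᵀ)]

lemma exists_index {d : ℕ} (α β ν : ℝ) (lam : Fin d → ℝ) (U Q : Matrix (Fin d) (Fin d) ℝ)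
    (hα : 0 < α) (hd : 0 < d)
    (hU : U * Uᵀ = 1) (hQ : Q = U * Matrix.diagonal lam * Uᵀ)
    (hS : ∀ j, Stab α β ν (lam j)) (Δ : Matrix (Fin d) (Fin d) ℂ)
    (h : 1 ≤ spectralRadius ℂ (AQc α β ν Q + Bc (d := d) α * Δ * Tc lam U)) :
    ∃ j, rCoef α β ν (lam j) ≤ α / √2 * ‖Δ‖ * √(lam j) := by
  haveI : Nonempty (Fin d) := ⟨⟨0, hd⟩⟩
  obtain ⟨z, hz, hzr⟩ := spectrum.exists_nnnorm_eq_spectralRadius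
    (AQc α β ν Q + Bc (d := d) α * Δ * Tc lam U)
  rw [← hzr] at h
  have hz1 : 1 ≤ ‖z‖ := by exact_mod_cast h
  rw [spec_iff α β ν lam U Q hU hQ] at hz
  obtain ⟨w, hw, hz⟩ := hz
  by_contra hcon
  push Not at hcon
  set pw : EuclideanSpace ℂ (Fin d) := WithLp.toLp 2
    (fun j => (z ^ 2 + bCoef α β ν (lam j) * z + cCoef α β ν (lam j)) * w j) with hpw
  set u : EuclideanSpace ℂ (Fin d) := WithLp.toLp 2 (fun j => ((√(lam j) : ℝ) : ℂ) * w j) with hu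
  have e : pw = (-(((α / √2 : ℝ) : ℂ) * z)) •
      WithLp.toLp 2 (((U.map Complex.ofReal)ᵀ * Δ) *ᵥ u) := by
    have := congrArg (fun x => (U.map Complex.ofReal)ᵀ *ᵥ x) hz
    simp only [Matrix.mulVec_mulVec, (map_U U hU).1, Matrix.one_mulVec, Matrix.mulVec_smul] at this
    rw [hpw, this, WithLp.toLp_smul]
  have hκ : 0 < α / √2 := by positivity
  have n1 : ‖pw‖ ≤ α / √2 * ‖z‖ * (‖Δ‖ * ‖u‖) := by
    rw [e, norm_smul, norm_neg, norm_mul, Complex.norm_real, Real.norm_of_nonneg hκ.le]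
    refine mul_le_mul_of_nonneg_left ?_ (by positivity)
    refine (Matrix.l2_opNorm_mulVec _ _).trans ?_
    refine mul_le_mul_of_nonneg_right ?_ (norm_nonneg _)
    refine (Matrix.l2_opNorm_mul _ _).trans ?_
    have := mul_le_mul_of_nonneg_right (norm_V U hU) (norm_nonneg Δ)
    linarith
  have n2 := pow_le_pow_left₀ (norm_nonneg _) n1 2
  have n3 : (α / √2 * ‖z‖ * (‖Δ‖ * ‖u‖)) ^ 2 < ‖pw‖ ^ 2 := by
    rw [show (α / √2 * ‖z‖ * (‖Δ‖ * ‖u‖)) ^ 2 = (α / √2 * ‖Δ‖ * ‖z‖) ^ 2 * ‖u‖ ^ 2 by ring,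
      EuclideanSpace.norm_sq_eq, EuclideanSpace.norm_sq_eq, Finset.mul_sum]
    have term : ∀ j, w j ≠ 0 → (α / √2 * ‖Δ‖ * ‖z‖) ^ 2 * ‖u j‖ ^ 2 < ‖pw j‖ ^ 2 := by
      intro j hj
      have a1 := p_lower (hS j) z hz1
      have a2 := hcon j
      have hwj : 0 < ‖w j‖ := norm_pos_iff.2 hj
      rw [← mul_pow]
      refine pow_lt_pow_left₀ ?_ (by positivity) two_ne_zero
      simp only [hu, hpw, norm_mul, Complex.norm_real, Real.norm_of_nonneg (Real.sqrt_nonneg _)]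
      calc α / √2 * ‖Δ‖ * ‖z‖ * (√(lam j) * ‖w j‖)
          = (α / √2 * ‖Δ‖ * √(lam j)) * ‖z‖ * ‖w j‖ := by ring
        _ < rCoef α β ν (lam j) * ‖z‖ * ‖w j‖ := by gcongr
        _ ≤ _ := by gcongr
    refine Finset.sum_lt_sum (fun j _ => ?_) ?_
    · by_cases hj : w j = 0
      · simp [hu, hpw, hj]
      · exact (term j hj).le
    · obtain ⟨j, hj⟩ := Function.ne_iff.1 hw
      exact ⟨j, Finset.mem_univ _, term j hj⟩
  linarith

lemma lower_bd {d : ℕ} (α β ν : ℝ) (lam : Fin d → ℝ) (U Q : Matrix (Fin d) (Fin d) ℝ)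
    (hα : 0 < α) (hd : 0 < d) (hlam : ∀ j, 0 < lam j) (l : ℝ) (hl : 0 < l)
    (hU : U * Uᵀ = 1) (hQ : Q = U * Matrix.diagonal lam * Uᵀ)
    (hS : ∀ j, Stab α β ν (lam j))
    (hmin : ∀ j, rCoef α β ν l ^ 2 / (α * l) ≤ rCoef α β ν (lam j) ^ 2 / (α * lam j))
    (Δ : Matrix (Fin d) (Fin d) ℂ)
    (h : 1 ≤ spectralRadius ℂ (AQc α β ν Q + Bc (d := d) α * Δ * Tc lam U)) :
    √2 * rCoef α β ν l / (α * √l) ≤ ‖Δ‖ := by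
  obtain ⟨j, hj⟩ := exists_index α β ν lam U Q hα hd hU hQ hS Δ h
  have hlj := hlam j
  have k := pow_le_pow_left₀ (rCoef_nonneg _ _ _ _) hj 2
  have k2 := hmin j
  have hs2 : √2 ^ 2 = (2 : ℝ) := Real.sq_sqrt (by norm_num)
  have hsl : √l ^ 2 = l := Real.sq_sqrt hl.le
  have hslj : √(lam j) ^ 2 = lam j := Real.sq_sqrt hlj.le
  rw [mul_pow, mul_pow, div_pow, hs2, hslj] at k
  rw [← sq_le_sq₀ (div_nonneg (mul_nonneg (by positivity) (rCoef_nonneg _ _ _ _)) (by positivity)) (norm_nonneg _),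
    div_pow, mul_pow, mul_pow, hs2, hsl]
  have k3 : rCoef α β ν (lam j) ^ 2 / (α * lam j) ≤ α / 2 * ‖Δ‖ ^ 2 := by
    rw [div_le_iff₀ (by positivity)]; linarith
  have k4 := k2.trans k3
  rw [div_le_iff₀ (by positivity)] at k4 ⊢
  nlinarith

lemma upper_bd {d : ℕ} (α β ν : ℝ) (lam : Fin d → ℝ) (U Q : Matrix (Fin d) (Fin d) ℝ)
    (hα : 0 < α) (l : ℝ) (hl : 0 < l)
    (hU : U * Uᵀ = 1) (hQ : Q = U * Matrix.diagonal lam * Uᵀ)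
    (hS : Stab α β ν l) (i k : Fin d) (hik : i ≠ k) (hi : lam i = l) (hk : lam k = l) :
    ∃ Δ : Matrix (Fin d) (Fin d) ℝ, ‖Δ‖ ≤ √2 * rCoef α β ν l / (α * √l) ∧
    1 ≤ spectralRadius ℂ (AQc α β ν Q + Bc (d := d) α * (Δ.map Complex.ofReal) * Tc lam U) := by
  obtain ⟨z, hz1, hz⟩ := p_attained hS
  set p : ℂ := z ^ 2 + bCoef α β ν l * z + cCoef α β ν l with hp
  set ζ : ℂ := -(((√2 / (α * √l) : ℝ) : ℂ) * p / z) with hζ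
  have hz0 : z ≠ 0 := by intro h; simp [h] at hz1
  have hsl : 0 < √l := Real.sqrt_pos.2 hl
  have hζn : ‖ζ‖ = √2 * rCoef α β ν l / (α * √l) := by
    rw [hζ, norm_neg, norm_div, norm_mul, hz, hz1, Complex.norm_real,
      Real.norm_of_nonneg (by positivity)]
    ring
  set R : Matrix (Fin d) (Fin d) ℝ := ζ.re • (Matrix.single i i 1 + Matrix.single k k 1) +
    ζ.im • (Matrix.single i k 1 - Matrix.single k i 1) with hR
  have hUt : Uᵀ * U = 1 := mul_eq_one_comm.1 hU
  have hRR : Rᵀ * R = Matrix.diagonal (fun j => if j = i ∨ j = k then ‖ζ‖ ^ 2 else 0) := by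
    have e : Matrix.diagonal (fun j => if j = i ∨ j = k then ‖ζ‖ ^ 2 else 0)
        = ‖ζ‖ ^ 2 • (Matrix.single i i (1 : ℝ) + Matrix.single k k 1) := by
      ext a b
      by_cases hab : a = b
      · subst hab
        by_cases h1 : a = i
        · subst h1; simp [Matrix.single_apply, hik, hik.symm]
        · by_cases h2 : a = k
          · subst h2; simp [Matrix.single_apply, hik, hik.symm]
          · simp [Matrix.single_apply, h1, h2, Ne.symm h1, Ne.symm h2, eq_comm]
      · rw [Matrix.diagonal_apply_ne _ hab]
        simp only [Matrix.smul_apply, Matrix.add_apply, Matrix.single_apply, smul_eq_mul]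
        rw [if_neg, if_neg]
        · simp
        · rintro ⟨rfl, rfl⟩; exact hab rfl
        · rintro ⟨rfl, rfl⟩; exact hab rfl
    rw [e, ← Complex.normSq_eq_norm_sq, Complex.normSq_apply, hR]
    simp only [Matrix.transpose_add, Matrix.transpose_sub, Matrix.transpose_smul,
      Matrix.transpose_single, add_mul, mul_add, sub_mul, mul_sub, Matrix.smul_mul, Matrix.mul_smul,
      Matrix.single_mul_single_same, Matrix.single_mul_single_of_ne _ _ _ _ hik,
      Matrix.single_mul_single_of_ne _ _ _ _ hik.symm, mul_one]
    module
  refine ⟨U * R, ?_, ?_⟩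
  · have c := Matrix.l2_opNorm_conjTranspose_mul_self (U * R)
    have e : (U * R)ᴴ * (U * R) = Matrix.diagonal (fun j => if j = i ∨ j = k then ‖ζ‖ ^ 2 else 0) := by
      rw [← hRR, Matrix.conjTranspose_eq_transpose_of_trivial, Matrix.transpose_mul,
        Matrix.mul_assoc, ← Matrix.mul_assoc Uᵀ, hUt, Matrix.one_mul]
    rw [e, Matrix.l2_opNorm_diagonal] at c
    have b : ‖(fun j => if j = i ∨ j = k then ‖ζ‖ ^ 2 else 0 : Fin d → ℝ)‖ ≤ ‖ζ‖ ^ 2 := by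
      refine (pi_norm_le_iff_of_nonneg (by positivity)).2 fun j => ?_
      split_ifs
      · simp
      · simp
    rw [← hζn, ← sq_le_sq₀ (norm_nonneg _) (norm_nonneg _), sq, ← c]
    exact b
  · have hzs : z ∈ spectrum ℂ
        (AQc α β ν Q + Bc (d := d) α * ((U * R).map Complex.ofReal) * Tc lam U) := by
      rw [spec_iff α β ν lam U Q hU hQ]
      refine ⟨Pi.single i 1 + Pi.single k Complex.I, ?_, ?_⟩
      · intro h
        have := congrFun h i
        simp [hik] at this
      · have f1 : ∀ g : ℝ → ℂ, (fun j => g (lam j) *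
            ((Pi.single i 1 + Pi.single k Complex.I : Fin d → ℂ) j)) =
            g l • (Pi.single i 1 + Pi.single k Complex.I : Fin d → ℂ) := by
          intro g
          ext j
          by_cases h1 : j = i
          · subst h1; simp [hi]
          · by_cases h2 : j = k
            · subst h2; simp [hk]
            · simp [h1, h2]
        rw [f1 (fun y => z ^ 2 + bCoef α β ν y * z + cCoef α β ν y), f1 (fun y => ((√y : ℝ) : ℂ))]
        have hm : (U * R).map Complex.ofReal = U.map Complex.ofReal * R.map Complex.ofReal :=
          Matrix.map_mul (f := Complex.ofRealHom)
        have hRw : R.map Complex.ofReal *ᵥ (Pi.single i 1 + Pi.single k Complex.I) =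
            ζ • (Pi.single i 1 + Pi.single k Complex.I : Fin d → ℂ) := by
          ext j
          rw [Matrix.mulVec_add, Matrix.mulVec_single, Matrix.mulVec_single]
          have hζe := Complex.re_add_im ζ
          by_cases h1 : j = i
          · subst h1
            simp [hR, Matrix.single_apply, hik, hik.symm]
            linear_combination hζe
          · by_cases h2 : j = k
            · subst h2
              simp [hR, Matrix.single_apply, hik, hik.symm]
              linear_combination Complex.I * hζe - ζ.im * Complex.I_mul_I
            · simp [hR, Matrix.single_apply, h1, h2, Ne.symm h1, Ne.symm h2]
        rw [hm, ← Matrix.mulVec_mulVec, Matrix.mulVec_smul (R.map Complex.ofReal), hRw]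
        simp only [Matrix.mulVec_smul, smul_smul]
        congr 1
        rw [← hp, hζ]
        have h2 : ((√2 : ℝ) : ℂ) ≠ 0 := by
          exact_mod_cast (Real.sqrt_pos.2 (by norm_num : (0 : ℝ) < 2)).ne'
        have h3 : ((√l : ℝ) : ℂ) ≠ 0 := by exact_mod_cast hsl.ne'
        have h4 : (α : ℂ) ≠ 0 := by exact_mod_cast hα.ne'
        push_cast
        field_simp
    have : (‖z‖₊ : ENNReal) ≤ spectralRadius ℂ
        (AQc α β ν Q + Bc (d := d) α * ((U * R).map Complex.ofReal) * Tc lam U) :=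
      le_iSup₂ (α := ENNReal) z hzs
    have hz1' : ‖z‖₊ = 1 := by ext; exact hz1
    rw [hz1'] at this
    exact_mod_cast this

lemma stab_all {d : ℕ} (α β ν : ℝ) (lam : Fin d → ℝ) (U Q : Matrix (Fin d) (Fin d) ℝ)
    (hα : 0 < α) (hlam : ∀ j, 0 < lam j)
    (hU : U * Uᵀ = 1) (hQ : Q = U * Matrix.diagonal lam * Uᵀ)
    (hρ : spectralRadius ℂ (AQc α β ν Q) < 1) (j : Fin d) : Stab α β ν (lam j) := by
  apply stab_of_roots
  · intro z hz
    have hzs : z ∈ spectrum ℂ (AQc α β ν Q + Bc (d := d) α * (0 : Matrix (Fin d) (Fin d) ℂ) * Tc lam U) := by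
      rw [spec_iff α β ν lam U Q hU hQ]
      refine ⟨Pi.single j 1, by simp, ?_⟩
      have : (fun i => (z ^ 2 + bCoef α β ν (lam i) * z + cCoef α β ν (lam i)) *
          (Pi.single j 1 : Fin d → ℂ) i) = 0 := by
        ext i
        by_cases h : i = j
        · subst h; simp [hz]
        · simp [h]
      rw [this]; simp
    rw [Matrix.mul_zero, Matrix.zero_mul, add_zero] at hzs
    have h1 : (‖z‖₊ : ENNReal) ≤ spectralRadius ℂ (AQc α β ν Q) :=
      le_iSup₂ (α := ENNReal) z hzs
    have h2 := h1.trans_lt hρ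
    exact_mod_cast h2
  · have := mul_pos hα (hlam j)
    unfold bCoef cCoef; linarith

lemma core {d : ℕ} (α β ν : ℝ) (lam : Fin d → ℝ) (U Q : Matrix (Fin d) (Fin d) ℝ)
    (hα : 0 < α) (hlam : ∀ j, 0 < lam j) (l : ℝ)
    (hU : U * Uᵀ = 1) (hQ : Q = U * Matrix.diagonal lam * Uᵀ)
    (hS : ∀ j, Stab α β ν (lam j))
    (hmin : ∀ j, rCoef α β ν l ^ 2 / (α * l) ≤ rCoef α β ν (lam j) ^ 2 / (α * lam j))
    (i k : Fin d) (hik : i ≠ k) (hi : lam i = l) (hk : lam k = l) :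
    rReal α β ν Q lam U = √2 * rCoef α β ν l / (α * √l) ∧
    rComplex α β ν Q lam U = √2 * rCoef α β ν l / (α * √l) := by
  have hd : 0 < d := i.pos
  have hl : 0 < l := hi ▸ hlam i
  obtain ⟨Δ, hΔ, hsp⟩ := upper_bd α β ν lam U Q hα l hl hU hQ (hi ▸ hS i) i k hik hi hk
  have lo := lower_bd α β ν lam U Q hα hd hlam l hl hU hQ hS hmin
  unfold rReal rComplex
  have L1 : ∀ ε ∈ {ε : ℝ | ∃ Δ : Matrix (Fin d) (Fin d) ℝ, ‖Δ‖ = ε ∧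
    1 ≤ spectralRadius ℂ (AQc α β ν Q + Bc (d := d) α * (Δ.map Complex.ofReal) * Tc lam U)},
      √2 * rCoef α β ν l / (α * √l) ≤ ε := by
    rintro _ ⟨D, rfl, hD⟩
    exact (lo _ hD).trans (norm_map_le D)
  have L2 : ∀ ε ∈ {ε : ℝ | ∃ Δ : Matrix (Fin d) (Fin d) ℂ, ‖Δ‖ = ε ∧
    1 ≤ spectralRadius ℂ (AQc α β ν Q + Bc (d := d) α * Δ * Tc lam U)},
      √2 * rCoef α β ν l / (α * √l) ≤ ε := by
    rintro _ ⟨D, rfl, hD⟩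
    exact lo _ hD
  constructor
  · exact le_antisymm ((csInf_le ⟨_, L1⟩ ⟨Δ, rfl, hsp⟩).trans hΔ)
      (le_csInf ⟨‖Δ‖, Δ, rfl, hsp⟩ L1)
  · exact le_antisymm ((csInf_le ⟨_, L2⟩ ⟨_, rfl, hsp⟩).trans ((norm_map_le Δ).trans hΔ))
      (le_csInf ⟨‖Δ.map Complex.ofReal‖, _, rfl, hsp⟩ L2)

lemma ratio_sq {α r l r' l' : ℝ} (hα : 0 < α) (hl : 0 < l) (hl' : 0 < l') (hr : 0 < r)
    (hr' : 0 < r') (h : √l' / r' ≤ √l / r) : r ^ 2 / (α * l) ≤ r' ^ 2 / (α * l') := by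
  have k := pow_le_pow_left₀ (by positivity) h 2
  rw [div_pow, div_pow, Real.sq_sqrt hl.le, Real.sq_sqrt hl'.le,
    div_le_div_iff₀ (by positivity) (by positivity)] at k
  rw [div_le_div_iff₀ (by positivity) (by positivity)]
  nlinarith

/-- if both extreme eigenvalues of `Q` have multiplicity at least two
(`λ₂ = μ` and `λ_{d−1} = L`, `d ≥ 4`), the real and complex stability radii of the GMM
system coincide and equal `1/H∞`. -/
theorem real_eq_complex_stability_radius_multiplicity (d : ℕ) (hd : 4 ≤ d) (μ L : ℝ)
    (hμ : 0 < μ) (hμL : μ < L) (α β ν : ℝ) (hα : 0 < α) (hβ : 0 ≤ β) (hν : 0 ≤ ν)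
    (lam : Fin d → ℝ) (hlampos : ∀ j, 0 < lam j) (hlammono : Monotone lam)
    (hlam0 : lam ⟨0, by omega⟩ = μ) (hlamtop : lam ⟨d - 1, by omega⟩ = L)
    (hlam1 : lam ⟨1, by omega⟩ = μ) (hlampretop : lam ⟨d - 2, by omega⟩ = L)
    (U : Matrix (Fin d) (Fin d) ℝ) (hU : U * Uᵀ = 1)
    (Q : Matrix (Fin d) (Fin d) ℝ) (hQ : Q = U * Matrix.diagonal lam * Uᵀ)
    (hρ : spectralRadius ℂ (AQc α β ν Q) < 1) :
    rReal α β ν Q lam U = rComplex α β ν Q lam U ∧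
    rComplex α β ν Q lam U =
      1 / (α / Real.sqrt 2 *
        max (Real.sqrt μ / rCoef α β ν μ) (Real.sqrt L / rCoef α β ν L)) := by
  have hS := stab_all α β ν lam U Q hα hlampos hU hQ hρ
  have hSμ : Stab α β ν μ := hlam0 ▸ hS _
  have hSL : Stab α β ν L := hlamtop ▸ hS _
  have hL : 0 < L := hμ.trans hμL
  have lb : ∀ j, μ ≤ lam j := fun j => hlam0 ▸ hlammono (by simp [Fin.le_def])
  have ub : ∀ j, lam j ≤ L := fun j => hlamtop ▸ hlammono (by
    simp only [Fin.le_def]; have := j.2; omega)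
  have rμ := rCoef_pos hSμ
  have rL := rCoef_pos hSL
  have fin : ∀ l r : ℝ, 0 < l → 0 < r →
      1 / (α / √2 * (√l / r)) = √2 * r / (α * √l) := by
    intro l r hl hr
    have := Real.sqrt_pos.2 hl
    field_simp
  rcases le_total (√L / rCoef α β ν L) (√μ / rCoef α β ν μ) with h | h
  · have q := ratio_sq hα hμ hL rμ rL h
    obtain ⟨h1, h2⟩ := core α β ν lam U Q hα hlampos μ hU hQ hS
      (fun j => qc hα hβ hν hμ hSμ hSL (lb j) (ub j) le_rfl q)
      ⟨0, by omega⟩ ⟨1, by omega⟩ (by simp) hlam0 hlam1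
    rw [max_eq_left h, fin _ _ hμ rμ, h1, h2]
    exact ⟨rfl, rfl⟩
  · have q := ratio_sq hα hL hμ rL rμ h
    obtain ⟨h1, h2⟩ := core α β ν lam U Q hα hlampos L hU hQ hS
      (fun j => qc hα hβ hν hμ hSμ hSL (lb j) (ub j) q le_rfl)
      ⟨d - 1, by omega⟩ ⟨d - 2, by omega⟩ (by simp only [ne_eq, Fin.mk.injEq]; omega)
      hlamtop hlampretop
    rw [max_eq_right h, fin _ _ hL rL, h1, h2]
    exact ⟨rfl, rfl⟩
end

section
/- Let 0 < α < 2/L and define γ := 1/√(2μ) if 0 < α ≤ 1/L; γ := (1/√(2μ))·αL/(2 − αL) if 1/L < α ≤ 2/(L + √(Lμ)); γ := √κ/√(2μ) if 2/(L + √(Lμ)) < α ≤ 2/(L + μ); and γ := α√L/(√2·(2 − αL)) if 2/(L + μ) < α < 2/L. Then there exists a constant h₀ ≥ 0, depending only on α, μ, L, such that for every initialization x₀ ∈ ℝ^d and every error sequence with Σ_{k≥0} ‖w_k‖² < ∞, the inexact gradient-descent iterates satisfy Σ_{k≥0} (f(x_k) − f_*) ≤ γ²·Σ_{k≥0} ‖w_k‖²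 + h₀·(f(x₀) − f_*). In particular the ℓ2 gain of inexact gradient descent is at most γ. -/
section helpers
variable {E : Type*} [NormedAddCommGroup E] [InnerProductSpace ℝ E]

lemma aux_sum (F V W : ℕ → ℝ) (b : ℝ) (hb : 0 ≤ b) (hF : ∀ k, 0 ≤ F k) (hV : ∀ k, 0 ≤ V k)
    (hW : ∀ k, 0 ≤ W k) (hs : Summable W) (h : ∀ k, F k ≤ V k - V (k+1) + b * W k) :
    Summable F ∧ ∑' k, F k ≤ b * (∑' k, W k) + V 0 := by
  have key : ∀ n, ∑ k ∈ Finset.range n, F k ≤ b * (∑' k, W k) + V 0 := by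
    intro n
    have h1 : ∑ k ∈ Finset.range n, F k ≤ V 0 - V n + b * ∑ k ∈ Finset.range n, W k := by
      induction n with
      | zero => simp
      | succ n ih =>
        rw [Finset.sum_range_succ, Finset.sum_range_succ]
        linarith [h n]
    have h2 : ∑ k ∈ Finset.range n, W k ≤ ∑' k, W k := hs.sum_le_tsum _ (fun k _ => hW k)
    have h3 := mul_le_mul_of_nonneg_left h2 hb
    linarith [hV n]
  exact ⟨summable_of_sum_range_le hF key, Real.tsum_le_of_sum_range_le hF key⟩

lemma aux_line [CompleteSpace E] (f : E → ℝ) (hf : Differentiable ℝ f) (x v : E) (t : ℝ) :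
    HasDerivAt (fun t : ℝ => f (x + t • v)) (inner ℝ (gradient f (x + t • v)) v) t := by
  have h1 : HasFDerivAt f (fderiv ℝ f (x + t • v)) (x + t • v) := (hf _).hasFDerivAt
  have h2 : HasDerivAt (fun t : ℝ => x + t • v) v t := by
    simpa using ((hasDerivAt_id t).smul_const v).const_add x
  have h3 := h1.comp_hasDerivAt t h2
  have h4 : (fderiv ℝ f (x + t • v)) v = inner ℝ (gradient f (x + t • v)) v := by
    simp [gradient]
  rw [← h4]; exact h3

lemma aux_up [CompleteSpace E] (f : E → ℝ) (hf : Differentiable ℝ f) (L : ℝ)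
    (hL : ∀ x y : E, ‖gradient f x - gradient f y‖ ≤ L * ‖x - y‖) (x y : E) :
    f y ≤ f x + inner ℝ (gradient f x) (y - x) + L / 2 * ‖y - x‖ ^ 2 := by
  set v := y - x with hv
  have hd : ∀ t : ℝ, HasDerivAt (fun t : ℝ => f (x + t • v) - t * inner ℝ (gradient f x) v
      - L / 2 * ‖v‖ ^ 2 * t ^ 2)
      (inner ℝ (gradient f (x + t • v)) v - inner ℝ (gradient f x) v - L * ‖v‖ ^ 2 * t) t := by
    intro t
    have := ((aux_line f hf x v t).sub ((hasDerivAt_id t).mul_const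
      (inner ℝ (gradient f x) v))).sub (((hasDerivAt_id t).pow 2).const_mul (L / 2 * ‖v‖ ^ 2))
    refine HasDerivAt.congr_deriv this ?_
    simp only [id]; ring
  have hanti := antitoneOn_of_deriv_nonpos (convex_Icc (0:ℝ) 1)
    (fun t _ => (hd t).continuousAt.continuousWithinAt)
    (fun t _ => (hd t).differentiableAt.differentiableWithinAt) (by
      intro t ht
      rw [interior_Icc] at ht
      rw [(hd t).deriv, ← inner_sub_left]
      have h1 := real_inner_le_norm (gradient f (x + t • v) - gradient f x) v
      have h2 := hL (x + t • v) x
      rw [add_sub_cancel_left, norm_smul, Real.norm_of_nonneg ht.1.le] at h2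
      have h3 := mul_le_mul_of_nonneg_right h2 (norm_nonneg v)
      nlinarith)
  have := hanti (Set.left_mem_Icc.2 zero_le_one) (Set.right_mem_Icc.2 zero_le_one) zero_le_one
  have hy : y = x + v := by simp [hv]
  rw [hy]
  generalize gradient f x = G at this ⊢
  simp at this
  linarith

lemma aux_low [CompleteSpace E] (f : E → ℝ) (hf : Differentiable ℝ f) (μ : ℝ)
    (hc : ConvexOn ℝ Set.univ (fun x => f x - μ / 2 * ‖x‖ ^ 2)) (x y : E) :
    f x + inner ℝ (gradient f x) (y - x) + μ / 2 * ‖y - x‖ ^ 2 ≤ f y := by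
  set v := y - x with hv
  have hy : y = x + v := by simp [hv]
  have hconv : ConvexOn ℝ Set.univ (fun t : ℝ => f (x + t • v) - μ / 2 * ‖x + t • v‖ ^ 2) := by
    refine ⟨convex_univ, ?_⟩
    intro s _ t _ a b ha hb hab
    have := hc.2 (Set.mem_univ (x + s • v)) (Set.mem_univ (x + t • v)) ha hb hab
    have e : a • (x + s • v) + b • (x + t • v) = x + (a • s + b • t) • v := by
      have : x = (a + b) • x := by rw [hab, one_smul]
      conv_rhs => rw [this]
      simp only [smul_eq_mul]
      module
    rw [e] at this
    exact this
  have hn : ∀ t : ℝ, ‖x + t • v‖ ^ 2 = ‖x‖ ^ 2 + 2 * t * inner ℝ x v + t ^ 2 * ‖v‖ ^ 2 := by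
    intro t
    rw [norm_add_sq_real, inner_smul_right, norm_smul, mul_pow, Real.norm_eq_abs, sq_abs]; ring
  have hd : HasDerivAt (fun t : ℝ => f (x + t • v) - μ / 2 * ‖x + t • v‖ ^ 2)
      (inner ℝ (gradient f x) v - μ * inner ℝ x v) 0 := by
    simp only [hn]
    have h0 := aux_line f hf x v 0
    have h1 := ((((hasDerivAt_id (0:ℝ)).const_mul 2).mul_const (inner ℝ x v)).const_add
      (‖x‖ ^ 2)).add (((hasDerivAt_id (0:ℝ)).pow 2).mul_const (‖v‖ ^ 2))
    have := h0.sub (h1.const_mul (μ / 2))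
    refine HasDerivAt.congr_deriv this ?_
    rw [zero_smul, add_zero]
    simp only [id]; ring
  have := hconv.le_slope_of_hasDerivAt (Set.mem_univ 0) (Set.mem_univ 1) zero_lt_one hd
  rw [slope_def_field] at this
  simp only [hn] at this
  rw [hy]
  generalize gradient f x = G at this ⊢
  simp at this
  linarith

lemma aux_pl (f : E → ℝ) (g : E → E) (μ : ℝ) (hμ : 0 < μ)
    (hlow : ∀ x y, f x + inner ℝ (g x) (y - x) + μ / 2 * ‖y - x‖ ^ 2 ≤ f y) (x y : E) :
    2 * μ * (f x - f y) ≤ ‖g x‖ ^ 2 := by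
  have h := hlow x y
  have h2 : 0 ≤ ‖g x + μ • (y - x)‖ ^ 2 := by positivity
  rw [norm_add_sq_real, inner_smul_right, norm_smul, mul_pow, Real.norm_eq_abs, sq_abs] at h2
  have h3 := mul_le_mul_of_nonneg_left h (by positivity : 0 ≤ 2 * μ)
  nlinarith

lemma aux_half (f : E → ℝ) (g : E → E) (μ L : ℝ) (hμL : μ < L)
    (hlow : ∀ x y, f x + inner ℝ (g x) (y - x) + μ / 2 * ‖y - x‖ ^ 2 ≤ f y)
    (hup : ∀ x y, f y ≤ f x + inner ℝ (g x) (y - x) + L / 2 * ‖y - x‖ ^ 2) (x y : E) :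
    f x - f y + inner ℝ (g x) (y - x) + μ / 2 * ‖y - x‖ ^ 2
      + 1 / (2 * (L - μ)) * ‖g y - g x - μ • (y - x)‖ ^ 2 ≤ 0 := by
  set D := y - x with hD
  set p := g y - g x - μ • D with hp
  have hL : 0 < L - μ := sub_pos.2 hμL
  set t := 1 / (L - μ) with ht
  have ht1 : t * (L - μ) = 1 := by rw [ht]; field_simp
  have h1 := hlow x (y + (-t) • p)
  have h2 := hup y (y + (-t) • p)
  have e1 : y + (-t) • p - x = D + (-t) • p := by rw [hD]; abel
  rw [e1, inner_add_right, norm_add_sq_real, norm_smul, inner_smul_right, inner_smul_right,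
    mul_pow, Real.norm_eq_abs, sq_abs] at h1
  rw [add_sub_cancel_left, norm_smul, inner_smul_right, mul_pow, Real.norm_eq_abs, sq_abs] at h2
  have h3 : ‖p‖ ^ 2 = inner ℝ (g y) p - inner ℝ (g x) p - μ * inner ℝ D p := by
    rw [← real_inner_self_eq_norm_sq]
    nth_rw 1 [hp]
    rw [inner_sub_left, inner_sub_left, inner_smul_left]; simp
  have h4 : 1 / (2 * (L - μ)) = t / 2 := by rw [ht]; field_simp
  rw [h4]
  have h5 : t ^ 2 * (L - μ) * ‖p‖ ^ 2 = t * ‖p‖ ^ 2 := by rw [pow_two, mul_assoc t t, ht1]; ring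
  have h6 : t * ‖p‖ ^ 2 = t * (inner ℝ (g y) p - inner ℝ (g x) p - μ * inner ℝ D p) := by rw [h3]
  linarith

lemma aux_coco (f : E → ℝ) (g : E → E) (μ L : ℝ) (hμL : μ < L)
    (hlow : ∀ x y, f x + inner ℝ (g x) (y - x) + μ / 2 * ‖y - x‖ ^ 2 ≤ f y)
    (hup : ∀ x y, f y ≤ f x + inner ℝ (g x) (y - x) + L / 2 * ‖y - x‖ ^ 2) (x y : E)
    (hy : g y = 0) :
    ‖g x‖ ^ 2 + μ * L * ‖x - y‖ ^ 2 ≤ (L + μ) * inner ℝ (g x) (x - y) := by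
  have h1 := aux_half f g μ L hμL hlow hup x y
  have h2 := aux_half f g μ L hμL hlow hup y x
  have hL : 0 < L - μ := sub_pos.2 hμL
  have e : y - x = -(x - y) := by abel
  rw [hy] at h1 h2
  rw [e] at h1
  have e2 : (0:E) - g x - μ • (-(x - y)) = -(g x - μ • (x - y)) := by
    rw [smul_neg]; abel
  rw [e2, norm_neg, norm_neg, inner_neg_right] at h1
  rw [sub_zero, inner_zero_left] at h2
  have h3 : ‖g x - μ • (x - y)‖ ^ 2
      = ‖g x‖ ^ 2 - 2 * (μ * inner ℝ (g x) (x - y)) + μ ^ 2 * ‖x - y‖ ^ 2 := by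
    rw [norm_sub_sq_real, inner_smul_right, norm_smul, mul_pow, Real.norm_eq_abs, sq_abs]
  rw [h3] at h1 h2
  set P := ‖g x‖ ^ 2 - 2 * (μ * inner ℝ (g x) (x - y)) + μ ^ 2 * ‖x - y‖ ^ 2 with hP
  have h5 : -inner ℝ (g x) (x - y) + μ * ‖x - y‖ ^ 2 + 1 / (L - μ) * P ≤ 0 := by
    have : 1 / (L - μ) * P = 2 * (1 / (2 * (L - μ)) * P) := by field_simp
    rw [this]; linarith
  have h6 := mul_le_mul_of_nonneg_left h5 hL.le
  have h7 : (L - μ) * (1 / (L - μ) * P) = P := by field_simp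
  rw [mul_zero, mul_add, h7] at h6
  nlinarith

lemma aux_contr (f : E → ℝ) (g : E → E) (μ L α ρ : ℝ) (hμL : μ < L) (hα : 0 < α) (hρ0 : 0 ≤ ρ)
    (hρ : (ρ = 1 - α * μ ∧ α * (L + μ) ≤ 2) ∨ (ρ = α * L - 1 ∧ 2 ≤ α * (L + μ)))
    (hlow : ∀ x y, f x + inner ℝ (g x) (y - x) + μ / 2 * ‖y - x‖ ^ 2 ≤ f y)
    (hup : ∀ x y, f y ≤ f x + inner ℝ (g x) (y - x) + L / 2 * ‖y - x‖ ^ 2) (x y : E)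
    (hy : g y = 0) :
    ‖x - y - α • g x‖ ≤ ρ * ‖x - y‖ := by
  have h := aux_coco f g μ L hμL hlow hup x y hy
  have hl1 := hlow x y
  have hl2 := hlow y x
  have hu1 := hup x y
  have hu2 := hup y x
  have e : y - x = -(x - y) := by abel
  rw [e, inner_neg_right, norm_neg] at hl1 hu1
  rw [hy, inner_zero_left] at hl2 hu2
  refine (pow_le_pow_iff_left₀ (norm_nonneg _) (by positivity) two_ne_zero).1 ?_
  rw [norm_sub_sq_real, inner_smul_right, norm_smul, mul_pow, Real.norm_eq_abs, sq_abs,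
    real_inner_comm]
  set I := inner ℝ (g x) (x - y)
  set N := ‖x - y‖ ^ 2 with hN
  have hI1 : 0 ≤ I - μ * N := by linarith
  have hI2 : 0 ≤ L * N - I := by linarith
  have hα2 := mul_le_mul_of_nonneg_left h (sq_nonneg α)
  rw [mul_pow, ← hN]
  rcases hρ with ⟨rfl, h2⟩ | ⟨rfl, h2⟩
  · have := mul_nonneg (mul_nonneg hα.le hI1) (sub_nonneg.2 h2)
    nlinarith
  · have := mul_nonneg (mul_nonneg hα.le hI2) (sub_nonneg.2 h2)
    nlinarith

/-- Distance-based bound. -/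
lemma aux_dist (f : E → ℝ) (g : E → E) (μ L α ρ : ℝ) (hμ : 0 < μ) (hμL : μ < L) (hα : 0 < α)
    (hρ0 : 0 ≤ ρ) (hρ1 : ρ < 1)
    (hρ : (ρ = 1 - α * μ ∧ α * (L + μ) ≤ 2) ∨ (ρ = α * L - 1 ∧ 2 ≤ α * (L + μ)))
    (hlow : ∀ x y, f x + inner ℝ (g x) (y - x) + μ / 2 * ‖y - x‖ ^ 2 ≤ f y)
    (hup : ∀ x y, f y ≤ f x + inner ℝ (g x) (y - x) + L / 2 * ‖y - x‖ ^ 2) (y : E)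
    (hy : g y = 0) (w x : ℕ → E) (hx : ∀ k, x (k+1) = x k - α • (g (x k) + w k))
    (hw : Summable (fun k => ‖w k‖ ^ 2)) :
    Summable (fun k => f (x k) - f y) ∧ ∑' k, (f (x k) - f y) ≤
      (L / 2 * (α / (1 - ρ)) ^ 2) * (∑' k, ‖w k‖ ^ 2) + (L / μ / (1 - ρ)) * (f (x 0) - f y) := by
  have hL : 0 < L := hμ.trans hμL
  have h1ρ : 0 < 1 - ρ := sub_pos.2 hρ1
  have hl : ∀ z, μ / 2 * ‖z - y‖ ^ 2 ≤ f z - f y := by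
    intro z
    have := hlow y z
    rw [hy, inner_zero_left] at this
    linarith
  have hu : ∀ z, f z - f y ≤ L / 2 * ‖z - y‖ ^ 2 := by
    intro z
    have := hup y z
    rw [hy, inner_zero_left] at this
    linarith
  have key := aux_sum (fun k => f (x k) - f y) (fun k => L / 2 / (1 - ρ) * ‖x k - y‖ ^ 2)
    (fun k => ‖w k‖ ^ 2) (L / 2 * (α / (1 - ρ)) ^ 2) (by positivity)
    (fun k => le_trans (by positivity) (hl (x k))) (fun k => by positivity)
    (fun k => by positivity) hw (by
      intro k
      refine (hu (x k)).trans ?_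
      have hc := aux_contr f g μ L α ρ hμL hα hρ0 hρ hlow hup (x k) y hy
      have e : x (k+1) - y = (x k - y - α • g (x k)) - α • w k := by
        rw [hx, smul_add]; abel
      have hb : ‖x (k+1) - y‖ ≤ ρ * ‖x k - y‖ + α * ‖w k‖ := by
        rw [e]
        refine (norm_sub_le _ _).trans ?_
        rw [norm_smul, Real.norm_of_nonneg hα.le]
        linarith
      have hb2 : ‖x (k+1) - y‖ ^ 2 ≤ (ρ * ‖x k - y‖ + α * ‖w k‖) ^ 2 :=
        pow_le_pow_left₀ (norm_nonneg _) hb 2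
      have hb3 : (ρ * ‖x k - y‖ + α * ‖w k‖) ^ 2
          ≤ ρ * ‖x k - y‖ ^ 2 + α ^ 2 / (1 - ρ) * ‖w k‖ ^ 2 := by
        have : ρ * ‖x k - y‖ ^ 2 + α ^ 2 / (1 - ρ) * ‖w k‖ ^ 2
          - (ρ * ‖x k - y‖ + α * ‖w k‖) ^ 2
          = ρ / (1 - ρ) * ((1 - ρ) * ‖x k - y‖ - α * ‖w k‖) ^ 2 := by
          field_simp; ring
        have h0 : 0 ≤ ρ / (1 - ρ) * ((1 - ρ) * ‖x k - y‖ - α * ‖w k‖) ^ 2 := by positivity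
        linarith
      have hb4 := mul_le_mul_of_nonneg_left (hb2.trans hb3)
        (by positivity : 0 ≤ L / 2 / (1 - ρ))
      have e2 : L / 2 * ‖x k - y‖ ^ 2 = L / 2 / (1 - ρ) * ‖x k - y‖ ^ 2
        - L / 2 / (1 - ρ) * (ρ * ‖x k - y‖ ^ 2 + α ^ 2 / (1 - ρ) * ‖w k‖ ^ 2)
        + L / 2 * (α / (1 - ρ)) ^ 2 * ‖w k‖ ^ 2 := by
        field_simp; ring
      linarith)
  refine ⟨key.1, key.2.trans ?_⟩
  have h0 := mul_le_mul_of_nonneg_left (hl (x 0)) (by positivity : 0 ≤ L / μ / (1 - ρ))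
  have e : L / μ / (1 - ρ) * (μ / 2 * ‖x 0 - y‖ ^ 2) = L / 2 / (1 - ρ) * ‖x 0 - y‖ ^ 2 := by
    field_simp
  rw [e] at h0
  linarith

/-- Function-value-based bound. -/
lemma aux_val (f : E → ℝ) (g : E → E) (μ L α p q : ℝ) (hμ : 0 < μ) (hα : 0 < α)
    (hp : 0 < p) (hq : 0 ≤ q)
    (hpq : ∀ a b : E, - inner ℝ a (a + b) + α * L / 2 * ‖a + b‖ ^ 2
      ≤ - p / 2 * ‖a‖ ^ 2 + q / 2 * ‖b‖ ^ 2)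
    (hlow : ∀ x y, f x + inner ℝ (g x) (y - x) + μ / 2 * ‖y - x‖ ^ 2 ≤ f y)
    (hup : ∀ x y, f y ≤ f x + inner ℝ (g x) (y - x) + L / 2 * ‖y - x‖ ^ 2) (y : E)
    (hy : ∀ x, f y ≤ f x) (w x : ℕ → E) (hx : ∀ k, x (k+1) = x k - α • (g (x k) + w k))
    (hw : Summable (fun k => ‖w k‖ ^ 2)) :
    Summable (fun k => f (x k) - f y) ∧ ∑' k, (f (x k) - f y) ≤
      (q / p / (2 * μ)) * (∑' k, ‖w k‖ ^ 2) + (1 / (α * μ * p)) * (f (x 0) - f y) := by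
  have hF : ∀ z, 0 ≤ f z - f y := fun z => sub_nonneg.2 (hy z)
  refine aux_sum (fun k => f (x k) - f y) (fun k => 1 / (α * μ * p) * (f (x k) - f y))
    (fun k => ‖w k‖ ^ 2) (q / p / (2 * μ)) (by positivity)
    (fun k => hF _) (fun k => mul_nonneg (by positivity) (hF _))
    (fun k => by positivity) hw ?_
  intro k
  have h1 := hup (x k) (x (k+1))
  have e : x (k+1) - x k = (-α) • (g (x k) + w k) := by rw [hx, neg_smul]; abel
  rw [e, inner_smul_right, norm_smul, mul_pow, Real.norm_eq_abs, sq_abs] at h1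
  have h2 := mul_le_mul_of_nonneg_left (hpq (g (x k)) (w k)) hα.le
  have h3 := mul_le_mul_of_nonneg_left (aux_pl f g μ hμ hlow (x k) y)
    (by positivity : 0 ≤ α * p / 2)
  have h4 : f (x (k+1)) - f y ≤ (f (x k) - f y) - α * μ * p * (f (x k) - f y)
      + α * q / 2 * ‖w k‖ ^ 2 := by linarith
  have h5 := mul_le_mul_of_nonneg_left h4 (by positivity : 0 ≤ 1 / (α * μ * p))
  have e2 : 1 / (α * μ * p) * ((f (x k) - f y) - α * μ * p * (f (x k) - f y)
      + α * q / 2 * ‖w k‖ ^ 2) = 1 / (α * μ * p) * (f (x k) - f y) - (f (x k) - f y)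
      + q / p / (2 * μ) * ‖w k‖ ^ 2 := by
    field_simp
  linarith

lemma aux_r1 (a : ℝ) (ha : a ≤ 1) (u v : E) :
    - inner ℝ u (u + v) + a / 2 * ‖u + v‖ ^ 2 ≤ - 1 / 2 * ‖u‖ ^ 2 + 1 / 2 * ‖v‖ ^ 2 := by
  have h1 : a / 2 * ‖u + v‖ ^ 2 ≤ 1 / 2 * ‖u + v‖ ^ 2 := by gcongr
  rw [norm_add_sq_real u v] at h1 ⊢
  rw [inner_add_right, real_inner_self_eq_norm_sq]
  linarith

lemma aux_r2 (a : ℝ) (ha : 1 ≤ a) (ha2 : a < 2) (u v : E) :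
    - inner ℝ u (u + v) + a / 2 * ‖u + v‖ ^ 2
      ≤ - ((2 - a) / a) / 2 * ‖u‖ ^ 2 + (a / (2 - a)) / 2 * ‖v‖ ^ 2 := by
  have h2a : 0 < 2 - a := by linarith
  have ha0 : 0 < a := by linarith
  have h1 : 0 ≤ (a - 1) / (2 * a * (2 - a)) * ‖(2 - a) • u - a • v‖ ^ 2 :=
    mul_nonneg (div_nonneg (by linarith) (by positivity)) (by positivity)
  rw [norm_sub_sq_real, norm_smul, norm_smul, mul_pow, mul_pow, Real.norm_eq_abs, sq_abs,
    Real.norm_eq_abs, sq_abs, inner_smul_left, inner_smul_right] at h1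
  rw [inner_add_right, real_inner_self_eq_norm_sq, norm_add_sq_real]
  simp only [conj_trivial] at h1
  have e : - ((2 - a) / a) / 2 * ‖u‖ ^ 2 + (a / (2 - a)) / 2 * ‖v‖ ^ 2
      - (-(‖u‖ ^ 2 + inner ℝ u v) + a / 2 * (‖u‖ ^ 2 + 2 * inner ℝ u v + ‖v‖ ^ 2))
      = (a - 1) / (2 * a * (2 - a)) * ((2 - a) ^ 2 * ‖u‖ ^ 2
        - 2 * ((2 - a) * (a * inner ℝ u v)) + a ^ 2 * ‖v‖ ^ 2) := by
    field_simp; ring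
  linarith

end helpers

/-- ℓ2-gain bound for inexact gradient descent on a `μ`-strongly convex and
`L`-smooth function: there is a constant `h₀ ≥ 0` depending only on `α, μ, L` such that the
cumulative suboptimality is at most `γ²·Σ‖w_k‖² + h₀·(f(x₀) − f_*)`. -/
theorem gd_l2_gain_bound (μ L α : ℝ) (hμ : 0 < μ) (hμL : μ < L)
    (hα : 0 < α) (hα2 : α < 2 / L) :
    ∃ h₀ : ℝ, 0 ≤ h₀ ∧
      ∀ (d : ℕ), 1 ≤ d →
      ∀ f : EuclideanSpace ℝ (Fin d) → ℝ, Differentiable ℝ f →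
      ConvexOn ℝ Set.univ (fun x => f x - μ / 2 * ‖x‖ ^ 2) →
      (∀ x y : EuclideanSpace ℝ (Fin d), ‖gradient f x - gradient f y‖ ≤ L * ‖x - y‖) →
      ∀ xstar : EuclideanSpace ℝ (Fin d), (∀ x, f xstar ≤ f x) →
      ∀ w x : ℕ → EuclideanSpace ℝ (Fin d),
      (∀ k : ℕ, x (k + 1) = x k - α • (gradient f (x k) + w k)) →
      Summable (fun k : ℕ => ‖w k‖ ^ 2) →
      Summable (fun k : ℕ => f (x k) - f xstar) ∧
      (∑' k : ℕ, (f (x k) - f xstar)) ≤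
        (if α ≤ 1 / L then 1 / Real.sqrt (2 * μ)
          else if α ≤ 2 / (L + Real.sqrt (L * μ)) then
            1 / Real.sqrt (2 * μ) * (α * L / (2 - α * L))
          else if α ≤ 2 / (L + μ) then Real.sqrt (L / μ) / Real.sqrt (2 * μ)
          else α * Real.sqrt L / (Real.sqrt 2 * (2 - α * L))) ^ 2 *
          (∑' k : ℕ, ‖w k‖ ^ 2) + h₀ * (f (x 0) - f xstar) := by
  have hL : 0 < L := hμ.trans hμL
  have haL : α * L < 2 := by rwa [lt_div_iff₀ hL] at hα2
  have h2a : 0 < 2 - α * L := by linarith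
  have haμ : α * μ < α * L := mul_lt_mul_of_pos_left hμL hα
  have hαμ : 0 < α * μ := by positivity
  have hmin : ∀ (d : ℕ) (f : EuclideanSpace ℝ (Fin d) → ℝ) (y : EuclideanSpace ℝ (Fin d)),
      (∀ x, f y ≤ f x) → gradient f y = 0 := by
    intro d f y hy
    have : IsLocalMin f y := Filter.Eventually.of_forall hy
    simp [gradient, this.fderiv_eq_zero]
  split_ifs with c1 c2 c3
  · have ha1 : α * L ≤ 1 := by rwa [le_div_iff₀ hL] at c1
    refine ⟨1 / (α * μ * 1), by positivity, ?_⟩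
    intro d _ f hf hc hl y hy w x hx hw
    have := aux_val f (gradient f) μ L α 1 1 hμ hα one_pos zero_le_one
      (fun a b => aux_r1 _ ha1 a b) (aux_low f hf μ hc) (aux_up f hf L hl) y hy w x hx hw
    have e : (1 / Real.sqrt (2 * μ)) ^ 2 = 1 / 1 / (2 * μ) := by
      rw [div_pow, Real.sq_sqrt (by positivity)]; norm_num
    rw [e]; exact this
  · have ha1 : 1 ≤ α * L := by
      rw [le_div_iff₀ hL] at c1; linarith
    refine ⟨1 / (α * μ * ((2 - α * L) / (α * L))), by positivity, ?_⟩
    intro d _ f hf hc hl y hy w x hx hw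
    have := aux_val f (gradient f) μ L α ((2 - α * L) / (α * L)) (α * L / (2 - α * L)) hμ hα
      (by positivity) (by positivity)
      (fun a b => aux_r2 _ ha1 haL a b) (aux_low f hf μ hc) (aux_up f hf L hl) y hy w x hx hw
    have e : (1 / Real.sqrt (2 * μ) * (α * L / (2 - α * L))) ^ 2
        = (α * L / (2 - α * L)) / ((2 - α * L) / (α * L)) / (2 * μ) := by
      rw [mul_pow, div_pow, Real.sq_sqrt (by positivity)]; field_simp
    rw [e]; exact this
  · have h2 : α * (L + μ) ≤ 2 := by rwa [le_div_iff₀ (by positivity)] at c3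
    refine ⟨L / μ / (1 - (1 - α * μ)), by
      rw [sub_sub_cancel]; positivity, ?_⟩
    intro d _ f hf hc hl y hy w x hx hw
    have := aux_dist f (gradient f) μ L α (1 - α * μ) hμ hμL hα (by nlinarith) (by linarith)
      (Or.inl ⟨rfl, h2⟩) (aux_low f hf μ hc) (aux_up f hf L hl) y (hmin d f y hy) w x hx hw
    have e : (Real.sqrt (L / μ) / Real.sqrt (2 * μ)) ^ 2
        = L / 2 * (α / (1 - (1 - α * μ))) ^ 2 := by
      rw [div_pow, Real.sq_sqrt (by positivity), Real.sq_sqrt (by positivity), sub_sub_cancel]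
      field_simp
    rw [e]; exact this
  · have h2 : 2 ≤ α * (L + μ) := by
      rw [le_div_iff₀ (by positivity)] at c3; linarith
    have e1 : 1 - (α * L - 1) = 2 - α * L := by ring
    refine ⟨L / μ / (1 - (α * L - 1)), by rw [e1]; positivity, ?_⟩
    intro d _ f hf hc hl y hy w x hx hw
    have := aux_dist f (gradient f) μ L α (α * L - 1) hμ hμL hα (by nlinarith) (by linarith)
      (Or.inr ⟨rfl, h2⟩) (aux_low f hf μ hc) (aux_up f hf L hl) y (hmin d f y hy) w x hx hw
    have e : (α * Real.sqrt L / (Real.sqrt 2 * (2 - α * L))) ^ 2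
        = L / 2 * (α / (1 - (α * L - 1))) ^ 2 := by
      rw [e1, div_pow, mul_pow, mul_pow, Real.sq_sqrt (by positivity),
        Real.sq_sqrt (by positivity)]
      field_simp
    rw [e]; exact this
end

section
/- For every k ≥ 0 (with the conventions x_{−1} := x₀ and V_{−1} := V₀): V_{k+1} ≤ (ρ₀² + c₁ρ₁² + ρ₂²)·V_k − q_{M̃₂ + c₁M̃₁ + c₀M̃₀}(x_k − x_*, x_{k−1} − x_*, ∇f(y_k), w_k) + (c₁L/2)·α²·‖w_k‖² + α²·P̃₁₁·‖w_k‖² + a·‖w_k‖² + b·c₁·‖∇f(y_k)‖² + ρ₃²·V_{k−1}. -/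
open Matrix

/-- `Ã := [[1+β, −β],[1, 0]]`. -/
noncomputable def Atil (β : ℝ) : Matrix (Fin 2) (Fin 2) ℝ := !![1 + β, -β; 1, 0]

/-- `B̃ := (−α, 0)ᵀ`. -/
noncomputable def Btil (α : ℝ) : Matrix (Fin 2) (Fin 1) ℝ := !![-α; 0]

/-- `X̃₁`. -/
noncomputable def X1m (L α δ : ℝ) : Matrix (Fin 3) (Fin 3) ℝ :=
  (1 / 2 : ℝ) • !![-L * δ ^ 2, L * δ ^ 2, -(1 - α * L) * δ;
                   L * δ ^ 2, -L * δ ^ 2, (1 - α * L) * δ;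
                   -(1 - α * L) * δ, (1 - α * L) * δ, α * (2 - α * L)]

/-- `X̃₂`. -/
noncomputable def X2m (μ ν : ℝ) : Matrix (Fin 3) (Fin 3) ℝ :=
  (1 / 2 : ℝ) • !![ν ^ 2 * μ, -(ν ^ 2) * μ, -ν;
                   -(ν ^ 2) * μ, ν ^ 2 * μ, ν;
                   -ν, ν, 0]

/-- `X̃₃`. -/
noncomputable def X3m (μ ν : ℝ) : Matrix (Fin 3) (Fin 3) ℝ :=
  (1 / 2 : ℝ) • !![(1 + ν) ^ 2 * μ, -ν * (1 + ν) * μ, -(1 + ν);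
                   -ν * (1 + ν) * μ, ν ^ 2 * μ, ν;
                   -(1 + ν), ν, 0]

/-- `X̃₀ := X̃₁ + ρ₀²X̃₂ + (1−ρ₀²)X̃₃`. -/
noncomputable def X0m (μ L α ν δ ρ₀ : ℝ) : Matrix (Fin 3) (Fin 3) ℝ :=
  X1m L α δ + ρ₀ ^ 2 • X2m μ ν + (1 - ρ₀ ^ 2) • X3m μ ν

/-- `Z̃`. -/
noncomputable def Zm (μ ρ₁ ρ₂ ρ₃ : ℝ) (P : Matrix (Fin 2) (Fin 2) ℝ) :
    Matrix (Fin 3) (Fin 3) ℝ :=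
  !![ρ₁ ^ 2 * P 0 0 + μ / 2 * ρ₂ ^ 2, ρ₁ ^ 2 * P 0 1, 0;
     ρ₁ ^ 2 * P 0 1, ρ₁ ^ 2 * P 1 1 + μ / 2 * ρ₃ ^ 2, 0;
     0, 0, 0]

/-- `M̃₀`: top-left `2×2` block `2μL·C̃ᵀC̃`, entries `(1,3),(2,3)` from `−(μ+L)C̃ᵀ`,
entry `(3,3)` equal to `2`, rest zero (`C̃ = (1+ν, −ν)`). -/
noncomputable def M0m (μ L ν : ℝ) : Matrix (Fin 4) (Fin 4) ℝ :=
  !![2 * μ * L * (1 + ν) ^ 2, -(2 * μ * L * ν * (1 + ν)), -((μ + L) * (1 + ν)), 0;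
     -(2 * μ * L * ν * (1 + ν)), 2 * μ * L * ν ^ 2, (μ + L) * ν, 0;
     -((μ + L) * (1 + ν)), (μ + L) * ν, 2, 0;
     0, 0, 0, 0]

/-- `M̃₁`: top-left `3×3` block `X̃₀ + Z̃` and fourth column
`((Lαδ)/2, −(Lαδ)/2, α(1−Lα)/2, 0)ᵀ`. -/
noncomputable def M1m (μ L α ν δ ρ₀ ρ₁ ρ₂ ρ₃ : ℝ) (P : Matrix (Fin 2) (Fin 2) ℝ) :
    Matrix (Fin 4) (Fin 4) ℝ :=
  let W := X0m μ L α ν δ ρ₀ + Zm μ ρ₁ ρ₂ ρ₃ P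
  !![W 0 0, W 0 1, W 0 2, L * α * δ / 2;
     W 1 0, W 1 1, W 1 2, -(L * α * δ) / 2;
     W 2 0, W 2 1, W 2 2, α * (1 - L * α) / 2;
     L * α * δ / 2, -(L * α * δ) / 2, α * (1 - L * α) / 2, 0]

/-- `M̃₂`: top-left `2×2` block `−ÃᵀP̃Ã + ρ₀²P̃`, columns 3 and 4 (rows 1–2) given by
`−ÃᵀP̃B̃`, entry `(3,3)` equal to `−B̃ᵀP̃B̃ + bc₁`, entry `(3,4)` equal to `−B̃ᵀP̃B̃` and
entry `(4,4)` equal to `a`. -/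
noncomputable def M2m (α β ρ₀ a b c₁ : ℝ) (P : Matrix (Fin 2) (Fin 2) ℝ) :
    Matrix (Fin 4) (Fin 4) ℝ :=
  let PA := (Atil β)ᵀ * P * Atil β
  let PB := (Atil β)ᵀ * P * Btil α
  let pbb := ((Btil α)ᵀ * P * Btil α) 0 0
  !![-PA 0 0 + ρ₀ ^ 2 * P 0 0, -PA 0 1 + ρ₀ ^ 2 * P 0 1, -PB 0 0, -PB 0 0;
     -PA 1 0 + ρ₀ ^ 2 * P 1 0, -PA 1 1 + ρ₀ ^ 2 * P 1 1, -PB 1 0, -PB 1 0;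
     -PB 0 0, -PB 1 0, -pbb + b * c₁, -pbb;
     -PB 0 0, -PB 1 0, -pbb, a]

/-- The quadratic form `q_M(v₁,v₂,v₃,v₄) = Σᵢⱼ Mᵢⱼ⟨vᵢ,vⱼ⟩` of `M ⊗ I_d`. -/
noncomputable def qform {d : ℕ} (M : Matrix (Fin 4) (Fin 4) ℝ)
    (v : Fin 4 → EuclideanSpace ℝ (Fin d)) : ℝ :=
  ∑ i, ∑ j, M i j * @inner ℝ _ _ (v i) (v j)

/-- The Lyapunov value `V_k` (with the convention `x_{−1} = x₀` realized by truncated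
subtraction on `ℕ`). -/
noncomputable def Vlyap {d : ℕ} (f : EuclideanSpace ℝ (Fin d) → ℝ) (fstar c₁ : ℝ)
    (P : Matrix (Fin 2) (Fin 2) ℝ) (xstar : EuclideanSpace ℝ (Fin d))
    (x : ℕ → EuclideanSpace ℝ (Fin d)) (k : ℕ) : ℝ :=
  c₁ * (f (x k) - fstar) + P 0 0 * ‖x k - xstar‖ ^ 2 +
    2 * P 0 1 * @inner ℝ _ _ (x k - xstar) (x (k - 1) - xstar) +
    P 1 1 * ‖x (k - 1) - xstar‖ ^ 2

lemma gmm_line_deriv {d : ℕ} (f : EuclideanSpace ℝ (Fin d) → ℝ) (hdiff : Differentiable ℝ f)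
    (y v : EuclideanSpace ℝ (Fin d)) (t : ℝ) :
    HasDerivAt (fun t : ℝ => f (y + t • v)) (@inner ℝ _ _ (gradient f (y + t • v)) v) t := by
  have h1 : HasDerivAt (fun t : ℝ => y + t • v) v t := by
    simpa using ((hasDerivAt_id t).smul_const v).const_add y
  have h2 := (hdiff (y + t • v)).hasGradientAt.hasFDerivAt
  have h3 := h2.comp_hasDerivAt t h1
  rw [InnerProductSpace.toDual_apply_apply] at h3
  exact h3

lemma gmm_descent {d : ℕ} (L : ℝ) (f : EuclideanSpace ℝ (Fin d) → ℝ) (hdiff : Differentiable ℝ f)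
    (hsmooth : ∀ x y : EuclideanSpace ℝ (Fin d),
      ‖gradient f x - gradient f y‖ ≤ L * ‖x - y‖) (y v : EuclideanSpace ℝ (Fin d)) :
    f (y + v) ≤ f y + @inner ℝ _ _ (gradient f y) v + L / 2 * @inner ℝ _ _ v v := by
  have hd : ∀ t : ℝ, HasDerivAt
      (fun t : ℝ => f (y + t • v) - t * @inner ℝ _ _ (gradient f y) v
        - L / 2 * @inner ℝ _ _ v v * t ^ 2)
      (@inner ℝ _ _ (gradient f (y + t • v)) v - @inner ℝ _ _ (gradient f y) v
        - L / 2 * @inner ℝ _ _ v v * (2 * t)) t := by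
    intro t
    have h1 := (hasDerivAt_id t).mul_const (@inner ℝ _ _ (gradient f y) v)
    have h2 := ((hasDerivAt_pow 2 t)).const_mul (L / 2 * @inner ℝ _ _ v v)
    have := ((gmm_line_deriv f hdiff y v t).sub h1).sub h2
    refine this.congr_deriv ?_
    norm_num
  have hanti := antitoneOn_of_deriv_nonpos (convex_Icc (0 : ℝ) 1)
    (fun t _ => (hd t).continuousAt.continuousWithinAt)
    (fun t _ => (hd t).differentiableAt.differentiableWithinAt)
    (by
      intro t ht
      rw [interior_Icc] at ht
      rw [(hd t).deriv]
      have h1 := hsmooth (y + t • v) y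
      have h2 := real_inner_le_norm (gradient f (y + t • v) - gradient f y) v
      rw [inner_sub_left] at h2
      rw [add_sub_cancel_left, norm_smul, Real.norm_of_nonneg ht.1.le] at h1
      have h3 := mul_le_mul_of_nonneg_right h1 (norm_nonneg v)
      rw [real_inner_self_eq_norm_sq]
      nlinarith)
  have := hanti (Set.left_mem_Icc.2 zero_le_one) (Set.right_mem_Icc.2 zero_le_one) zero_le_one
  simp only [zero_smul, one_smul, add_zero, zero_mul, one_mul, one_pow, mul_one] at this
  norm_num at this ⊢
  linarith

lemma gmm_strong {d : ℕ} (μ : ℝ) (f : EuclideanSpace ℝ (Fin d) → ℝ) (hdiff : Differentiable ℝ f)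
    (hsc : ConvexOn ℝ Set.univ (fun x => f x - μ / 2 * ‖x‖ ^ 2))
    (y v : EuclideanSpace ℝ (Fin d)) :
    f y + @inner ℝ _ _ (gradient f y) v + μ / 2 * @inner ℝ _ _ v v ≤ f (y + v) := by
  have hc : ConvexOn ℝ Set.univ
      (fun t : ℝ => f (y + t • v) - μ / 2 * ‖y + t • v‖ ^ 2) := by
    have := hsc.comp_affineMap (AffineMap.lineMap y (y + v) : ℝ →ᵃ[ℝ] _)
    simpa [Function.comp_def, AffineMap.lineMap_apply, add_comm] using this
  have he : (fun t : ℝ => f (y + t • v) - μ / 2 * ‖y + t • v‖ ^ 2) =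
      fun t : ℝ => f (y + t • v) - μ / 2 * (@inner ℝ _ _ y y + 2 * @inner ℝ _ _ y v * t
        + @inner ℝ _ _ v v * t ^ 2) := by
    funext t
    rw [← real_inner_self_eq_norm_sq, inner_add_add_self]
    simp only [inner_smul_left, inner_smul_right, real_inner_comm y v, conj_trivial]
    ring
  rw [he] at hc
  have hd : HasDerivAt (fun t : ℝ => f (y + t • v) - μ / 2 * (@inner ℝ _ _ y y
        + 2 * @inner ℝ _ _ y v * t + @inner ℝ _ _ v v * t ^ 2))
      (@inner ℝ _ _ (gradient f y) v - μ * @inner ℝ _ _ y v) 0 := by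
    have h1 := ((((hasDerivAt_id (0 : ℝ)).const_mul (2 * @inner ℝ _ _ y v)).const_add
      (@inner ℝ _ _ y y)).add
      ((hasDerivAt_pow 2 (0 : ℝ)).const_mul (@inner ℝ _ _ v v))).const_mul (μ / 2)
    have := (gmm_line_deriv f hdiff y v 0).sub h1
    refine this.congr_deriv ?_
    norm_num
    ring
  have := hc.le_slope_of_hasDerivAt (Set.mem_univ 0) (Set.mem_univ 1) zero_lt_one hd
  rw [slope_def_field] at this
  norm_num at this ⊢
  linarith

lemma gmm_psd {d : ℕ} (P : Matrix (Fin 2) (Fin 2) ℝ) (hPsymm : P.IsSymm) (hPpsd : P.PosSemidef)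
    (e p : EuclideanSpace ℝ (Fin d)) :
    0 ≤ P 0 0 * @inner ℝ _ _ e e + 2 * P 0 1 * @inner ℝ _ _ e p + P 1 1 * @inner ℝ _ _ p p := by
  have h10 : P 1 0 = P 0 1 := hPsymm.apply 0 1
  have : P 0 0 * @inner ℝ _ _ e e + 2 * P 0 1 * @inner ℝ _ _ e p + P 1 1 * @inner ℝ _ _ p p
      = ∑ i, (P 0 0 * (e i * e i) + 2 * P 0 1 * (e i * p i) + P 1 1 * (p i * p i)) := by
    simp only [PiLp.inner_apply, Finset.sum_add_distrib, ← Finset.mul_sum]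
    simp [mul_comm, pow_two]
  rw [this]
  refine Finset.sum_nonneg fun i _ => ?_
  have := hPpsd.dotProduct_mulVec_nonneg ![e i, p i]
  simp [dotProduct, Matrix.mulVec, Fin.sum_univ_two, h10] at this
  linarith

lemma gmm_coco {d : ℕ} (μ L : ℝ) (hμL : μ < L)
    (f : EuclideanSpace ℝ (Fin d) → ℝ) 
    (hD : ∀ y v, f (y + v) ≤ f y + @inner ℝ _ _ (gradient f y) v + L / 2 * @inner ℝ _ _ v v)
    (hS : ∀ y v, f y + @inner ℝ _ _ (gradient f y) v + μ / 2 * @inner ℝ _ _ v v ≤ f (y + v))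
    (s z : EuclideanSpace ℝ (Fin d)) (hs : gradient f s = 0) :
    μ * L * @inner ℝ _ _ z z + @inner ℝ _ _ (gradient f (s + z)) (gradient f (s + z)) ≤
      (μ + L) * @inner ℝ _ _ z (gradient f (s + z)) := by
  have hpos : 0 < L - μ := sub_pos.2 hμL
  obtain ⟨r, hr⟩ : ∃ r, r = (L - μ)⁻¹ := ⟨_, rfl⟩
  have hr1 : r * (L - μ) = 1 := by rw [hr]; exact inv_mul_cancel₀ hpos.ne'
  have hr0 : 0 < r := by rw [hr]; positivity
  set g := gradient f (s + z) with hg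
  -- v = r (g - μ z)
  have a1 := hD (s + z) (-(r • (g - μ • z)))
  have a2 := hS s (z - r • (g - μ • z))
  have b1 := hD s (r • (g - μ • z))
  have b2 := hS (s + z) (-(z - r • (g - μ • z)))
  rw [show s + (z - r • (g - μ • z)) = s + z + -(r • (g - μ • z)) by abel] at a2
  rw [show s + z + -(z - r • (g - μ • z)) = s + r • (g - μ • z) by abel] at b2
  rw [hs] at a2 b1
  rw [← hg] at a1 b2
  simp only [inner_sub_left, inner_sub_right, inner_neg_left, inner_neg_right, inner_smul_left,
    inner_smul_right, inner_zero_left, real_inner_comm g z, conj_trivial] at a1 a2 b1 b2 ⊢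
  generalize @inner ℝ _ _ z z = Z at *
  generalize @inner ℝ _ _ g z = X at *
  generalize @inner ℝ _ _ g g = G at *
  have hL : L = μ + (L - μ) := by ring
  have key : r * (G - 2 * μ * X + μ ^ 2 * Z) ≤ X - μ * Z := by
    have e1 : r * r * (L - μ) = r := by rw [mul_assoc, hr1, mul_one]
    have e2 : ∀ T, r * r * (L - μ) * T = r * T := fun T => by rw [e1]
    have t1 := e2 G
    have t2 := e2 (μ * X)
    have t3 := e2 (μ ^ 2 * Z)
    nlinarith
  have := mul_le_mul_of_nonneg_right key hpos.le
  have e3 : r * (G - 2 * μ * X + μ ^ 2 * Z) * (L - μ) = G - 2 * μ * X + μ ^ 2 * Z := by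
    rw [mul_right_comm, hr1, one_mul]
  rw [e3] at this
  linarith

/-- one-step evolution of the Lyapunov function of inexact GMM
(Lemma `lemma-gmm-lyap-evolution`). -/
theorem gmm_lyapunov_evolution (d : ℕ) (hd : 1 ≤ d) (μ L : ℝ) (hμ : 0 < μ) (hμL : μ < L)
    (f : EuclideanSpace ℝ (Fin d) → ℝ) (hdiff : Differentiable ℝ f)
    (hsc : ConvexOn ℝ Set.univ (fun x => f x - μ / 2 * ‖x‖ ^ 2))
    (hsmooth : ∀ x y : EuclideanSpace ℝ (Fin d),
      ‖gradient f x - gradient f y‖ ≤ L * ‖x - y‖)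
    (xstar : EuclideanSpace ℝ (Fin d)) (hmin : ∀ x, f xstar ≤ f x)
    (α β ν : ℝ) (hα : 0 < α) (hβ : 0 ≤ β) (hν : 0 ≤ ν)
    (ρ₀ ρ₁ ρ₂ ρ₃ a b c₀ c₁ : ℝ)
    (hρ₀ : ρ₀ ∈ Set.Ico (0 : ℝ) 1) (hρ₁ : ρ₁ ∈ Set.Ico (0 : ℝ) 1)
    (hρ₂ : ρ₂ ∈ Set.Ico (0 : ℝ) 1) (hρ₃ : ρ₃ ∈ Set.Ico (0 : ℝ) 1)
    (ha : 0 ≤ a) (hb : 0 ≤ b) (hc₀ : 0 ≤ c₀) (hc₁ : 0 ≤ c₁)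
    (P : Matrix (Fin 2) (Fin 2) ℝ) (hPsymm : P.IsSymm) (hPpsd : P.PosSemidef)
    (hP : 0 < c₁ + P 0 0)
    (w x y : ℕ → EuclideanSpace ℝ (Fin d))
    (hy : ∀ k : ℕ, y k = x k + ν • (x k - x (k - 1)))
    (hrec : ∀ k : ℕ,
      x (k + 1) = x k - α • (gradient f (y k) + w k) + β • (x k - x (k - 1))) :
    ∀ k : ℕ,
      Vlyap f (f xstar) c₁ P xstar x (k + 1) ≤
        (ρ₀ ^ 2 + c₁ * ρ₁ ^ 2 + ρ₂ ^ 2) * Vlyap f (f xstar) c₁ P xstar x k -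
          qform (M2m α β ρ₀ a b c₁ P + c₁ • M1m μ L α ν (β - ν) ρ₀ ρ₁ ρ₂ ρ₃ P +
              c₀ • M0m μ L ν)
            ![x k - xstar, x (k - 1) - xstar, gradient f (y k), w k] +
          c₁ * L / 2 * α ^ 2 * ‖w k‖ ^ 2 + α ^ 2 * P 0 0 * ‖w k‖ ^ 2 +
          a * ‖w k‖ ^ 2 + b * c₁ * ‖gradient f (y k)‖ ^ 2 +
          ρ₃ ^ 2 * Vlyap f (f xstar) c₁ P xstar x (k - 1) := by
  intro k
  have hD := gmm_descent L f hdiff hsmooth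
  have hS := gmm_strong μ f hdiff hsc
  have hs : gradient f xstar = 0 := by
    have : IsLocalMin f xstar := Filter.Eventually.of_forall hmin
    rw [gradient, this.fderiv_eq_zero, map_zero]
  have hC := gmm_coco μ L hμL f hD hS xstar (y k - xstar) hs
  rw [add_sub_cancel] at hC
  have hS1 := hS (y k) (x k - y k)
  have hS2 := hS (y k) (xstar - y k)
  have hD1 := hD (y k) (x (k + 1) - y k)
  have hQ0 := hS xstar (x k - xstar)
  have hQ1 := hS xstar (x (k - 1) - xstar)
  have hP0 := gmm_psd P hPsymm hPpsd (x k - xstar) (x (k - 1) - xstar)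
  have hP1 := gmm_psd P hPsymm hPpsd (x (k - 1) - xstar) (x (k - 1 - 1) - xstar)
  rw [add_sub_cancel] at hS1 hS2 hD1 hQ0 hQ1
  rw [hs, inner_zero_left, add_zero] at hQ0 hQ1
  have h10 : P 1 0 = P 0 1 := hPsymm.apply 0 1
  have v1 : y k - xstar = (1 + ν) • (x k - xstar) - ν • (x (k - 1) - xstar) := by
    rw [hy k]; module
  have v2 : x k - y k = ν • (x (k - 1) - xstar) - ν • (x k - xstar) := by
    rw [hy k]; module
  have v3 : xstar - y k = ν • (x (k - 1) - xstar) - (1 + ν) • (x k - xstar) := by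
    rw [hy k]; module
  have v4 : x (k + 1) - y k = (β - ν) • (x k - xstar) - (β - ν) • (x (k - 1) - xstar)
      - α • gradient f (y k) - α • w k := by
    rw [hrec k]; generalize gradient f (y k) = g; rw [hy k]; module
  have v5 : x (k + 1) - xstar = (1 + β) • (x k - xstar) - β • (x (k - 1) - xstar)
      - α • gradient f (y k) - α • w k := by
    rw [hrec k]; module
  rw [v1] at hC
  rw [v2] at hS1
  rw [v3] at hS2
  rw [v4] at hD1
  unfold Vlyap
  rw [Nat.add_sub_cancel, v5]
  have hFs : 0 ≤ f (x k) - f xstar := sub_nonneg.2 (hmin _)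
  generalize f (x (k + 1)) = F1 at *
  generalize f (x k) = F0 at *
  generalize f (x (k - 1)) = Fm at *
  generalize f (y k) = Fy at *
  generalize f xstar = Fs at *
  generalize gradient f (y k) = g at *
  generalize x k - xstar = e at *
  generalize x (k - 1) - xstar = p at *
  generalize x (k - 1 - 1) - xstar = pp at *
  generalize w k = ω at *
  clear v1 v2 v3 v4 v5 hy hrec hD hS hs hsmooth hsc hdiff hmin
  simp only [qform, Fin.sum_univ_four, M2m, M1m, M0m, X0m, X1m, X2m, X3m, Zm, Atil, Btil,
    Matrix.mul_apply, Fin.sum_univ_two, Matrix.add_apply, Matrix.smul_apply, smul_eq_mul,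
    Matrix.transpose_apply, Matrix.of_apply, Matrix.cons_val, ← real_inner_self_eq_norm_sq,
    inner_sub_left, inner_sub_right, inner_smul_left, inner_smul_right, conj_trivial,
    real_inner_comm e p, real_inner_comm e g, real_inner_comm e ω, real_inner_comm p g,
    real_inner_comm p ω, real_inner_comm g ω, h10] at *
  generalize @inner ℝ _ _ e e = ee at *
  generalize @inner ℝ _ _ e p = ep at *
  generalize @inner ℝ _ _ e g = eg at *
  generalize @inner ℝ _ _ e ω = ew at *
  generalize @inner ℝ _ _ p p = p2 at *
  generalize @inner ℝ _ _ p g = pg at *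
  generalize @inner ℝ _ _ p ω = pw at *
  generalize @inner ℝ _ _ g g = gg at *
  generalize @inner ℝ _ _ g ω = gw at *
  generalize @inner ℝ _ _ ω ω = ww at *
  generalize @inner ℝ _ _ p pp = ppp at *
  generalize @inner ℝ _ _ pp pp = pppp at *
  have hρ : 0 ≤ 1 - ρ₀ ^ 2 := by nlinarith [hρ₀.1, hρ₀.2]
  have hF0 : 0 ≤ F0 - Fs - μ / 2 * ee := by linarith
  have hFm : 0 ≤ Fm - Fs - μ / 2 * p2 := by linarith
  have n1 := mul_le_mul_of_nonneg_left hD1 hc₁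
  have n2 := mul_le_mul_of_nonneg_left hS1 (mul_nonneg hc₁ (sq_nonneg ρ₀))
  have n3 := mul_le_mul_of_nonneg_left hS2 (mul_nonneg hc₁ hρ)
  have n4 := mul_le_mul_of_nonneg_left hC (mul_nonneg (zero_le_two (α := ℝ)) hc₀)
  have n5 : 0 ≤ c₁ * c₁ * ρ₁ ^ 2 * (F0 - Fs) := by
    have : 0 ≤ F0 - Fs := hFs
    positivity
  have n6 := mul_nonneg (sq_nonneg ρ₂) (add_nonneg (mul_nonneg hc₁ hF0) hP0)
  have n7 := mul_nonneg (sq_nonneg ρ₃) (add_nonneg (mul_nonneg hc₁ hFm) hP1)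
  linarith
end

section
/- For every initialization x₀ = x_{−1} ∈ ℝ^d, every error sequence (w_k)_{k≥0}, and every K ≥ 0, the averaged iterate x̄_K := (x₀ + x₁ + ⋯ + x_K)/(K+1) of the inexact NAG iterates satisfies f(x̄_K) − f_* ≤ (1/(K+1))·Σ_{j=0}^{K} (f(x_j) − f_*) ≤ L̄_NAG(α)²·(Σ_{j=0}^{K} ‖w_j‖²)/(K+1) + H̄(x₀)/(K+1) − (2/√(αμ))·(f(x_{K+1}) − f_*)/(K+1). -/
/-- `L̄_NAG(α)`, the explicit ℓ2-gain bound for NAG. -/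
noncomputable def LNAG (μ L α : ℝ) : ℝ :=
  Real.sqrt
    (4 * (5 - 2 * Real.sqrt (α * μ) + α * μ) / (μ * (1 + Real.sqrt (α * μ)) ^ 2) +
      Real.sqrt α * (1 + α * L) / Real.sqrt μ +
      8 * α ^ 3 * L ^ 4 * (4 + (1 - Real.sqrt (α * μ)) ^ 2) /
        (μ ^ 2 * (1 + Real.sqrt (α * μ)) ^ 2))

/-- `H̄(x₀)`, the initialization-dependent constant in the NAG ℓ2-gain bound. -/
noncomputable def HbarNAG {d : ℕ} (μ α : ℝ) (f : EuclideanSpace ℝ (Fin d) → ℝ)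
    (fstar : ℝ) (xstar x₀ : EuclideanSpace ℝ (Fin d)) : ℝ :=
  2 / Real.sqrt (α * μ) *
    (1 + Real.sqrt (α * μ) * (1 - Real.sqrt (α * μ)) /
        (4 * (5 - 2 * Real.sqrt (α * μ) + α * μ)) +
      Real.sqrt (α * μ) * (1 - Real.sqrt (α * μ)) ^ 2 /
        (4 * (4 + (1 - Real.sqrt (α * μ)) ^ 2))) *
    (f x₀ - fstar + μ / 2 * ‖x₀ - xstar‖ ^ 2)

section helpers
open RealInnerProductSpace
variable {E : Type*} [NormedAddCommGroup E] [InnerProductSpace ℝ E]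

theorem nag_stepA (μ L α s : ℝ) (hμ : 0 < μ) (hs : 0 < s) (hs1 : s < 1)
    (hα : α * μ = s ^ 2) (hα0 : 0 < α) (hL : L * α ≤ 1) (X Y V V' g w : E) (Fx Fy F' : ℝ)
    (hX : X = (1 + s) • Y - s • V)
    (hV' : V' = (1 - s) • V + s • Y - (α / s) • (g + w))
    (h1 : F' ≤ Fy - α * ⟪g, g + w⟫ + L * α ^ 2 / 2 * ‖g + w‖ ^ 2)
    (h2 : Fy + ⟪g, X - Y⟫ + μ / 2 * ‖X - Y‖ ^ 2 ≤ Fx)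
    (h3 : Fy - ⟪g, Y⟫ + μ / 2 * ‖Y‖ ^ 2 ≤ 0) :
    F' + μ / 2 * ‖V'‖ ^ 2 ≤ (1 - s) * (Fx + μ / 2 * ‖V‖ ^ 2) + α * (1 + L * α) / 2 * ‖w‖ ^ 2
      + α ^ 2 * L * ⟪g, w⟫ - s * ⟪w, (1 - s) • V + s • Y⟫ := by
  have hXY : X - Y = s • (Y - V) := by rw [hX]; module
  rw [hXY] at h2
  have hd : α / s = s / μ := by field_simp; linarith
  have e1 : μ / 2 * ‖V'‖ ^ 2 = μ / 2 * ‖(1 - s) • V + s • Y‖ ^ 2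
      - s * ⟪(1 - s) • V + s • Y, g + w⟫ + α / 2 * ‖g + w‖ ^ 2 := by
    rw [hV', norm_sub_sq_real, real_inner_smul_right, norm_smul, Real.norm_eq_abs, mul_pow, sq_abs]
    have a1 : μ * (α / s) = s := by rw [hd]; field_simp
    have a2 : μ * (α / s) ^ 2 = α := by
      rw [hd]; field_simp; linarith
    linear_combination (-⟪(1 - s) • V + s • Y, g + w⟫) * a1 + (‖g + w‖ ^ 2 / 2) * a2
  have p1 : 0 ≤ α * (1 - L * α) / 2 * ‖g‖ ^ 2 := by
    have : 0 ≤ 1 - L * α := by linarith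
    positivity
  have p2 : 0 ≤ (1 - s) * (μ / 2) * (s ^ 2 + s) * ‖Y - V‖ ^ 2 := by
    have : 0 ≤ 1 - s := by linarith
    positivity
  have h2' := mul_le_mul_of_nonneg_left h2 (by linarith : 0 ≤ 1 - s)
  have h3' := mul_le_mul_of_nonneg_left h3 hs.le
  rw [e1]
  simp only [← real_inner_self_eq_norm_sq, inner_add_left, inner_add_right, inner_sub_left,
    inner_sub_right, real_inner_smul_left, real_inner_smul_right] at *
  rw [real_inner_comm w g, real_inner_comm Y V, real_inner_comm V g, real_inner_comm Y g,
    real_inner_comm Y w, real_inner_comm V w] at *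
  nlinarith [h1, h2', h3', p1, p2]

theorem nag_stepB (μ L α s : ℝ) (hμ : 0 < μ) (hs : 0 < s) (hs1 : s < 1) (hL0 : 0 < L)
    (hα0 : 0 < α) (X Y V g w : E)
    (hX : X = (1 + s) • Y - s • V) (h4 : ‖g‖ ≤ L * ‖Y‖) :
    2 / s * (α ^ 2 * L * ⟪g, w⟫ - s * ⟪w, (1 - s) • V + s • Y⟫) ≤
      μ / 2 * ‖X‖ ^ 2 + μ * ‖V‖ ^ 2 +
      (16 + 32 * (α ^ 2 * L ^ 2 / s) ^ 2) / (μ * (1 + s) ^ 2) * ‖w‖ ^ 2 := by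
  have hs' : (0:ℝ) < 1 + s := by linarith
  set c := α ^ 2 * L ^ 2 / s with hc
  have hc0 : 0 ≤ c := by positivity
  have hY : Y = (1 / (1 + s)) • (X + s • V) := by
    rw [hX, sub_add_cancel, smul_smul]; field_simp; simp
  have hU : (1 - s) • V + s • Y = (1 / (1 + s)) • (V + s • X) := by
    rw [hY]
    match_scalars <;> field_simp <;> ring
  have nY : ‖Y‖ ≤ (1 / (1 + s)) * (‖X‖ + s * ‖V‖) := by
    rw [hY, norm_smul, Real.norm_of_nonneg (by positivity)]
    gcongr
    refine (norm_add_le _ _).trans ?_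
    rw [norm_smul, Real.norm_of_nonneg hs.le]
  have nU : ‖(1 - s) • V + s • Y‖ ≤ (1 / (1 + s)) * (‖V‖ + s * ‖X‖) := by
    rw [hU, norm_smul, Real.norm_of_nonneg (by positivity)]
    gcongr
    refine (norm_add_le _ _).trans ?_
    rw [norm_smul, Real.norm_of_nonneg hs.le]
  have i1 : ⟪g, w⟫ ≤ L * ((1 / (1 + s)) * (‖X‖ + s * ‖V‖)) * ‖w‖ :=
    (real_inner_le_norm _ _).trans (by gcongr; exact h4.trans (by gcongr))
  have i2 : -⟪w, (1 - s) • V + s • Y⟫ ≤ ‖w‖ * ((1 / (1 + s)) * (‖V‖ + s * ‖X‖)) :=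
    (neg_le_abs _).trans ((abs_real_inner_le_norm _ _).trans (by gcongr))
  set a := ‖X‖
  set b := ‖V‖
  set q := ‖w‖ / (1 + s) with hq
  have hq0 : 0 ≤ q := by positivity
  have ha : 0 ≤ a := norm_nonneg _
  have hb : 0 ≤ b := norm_nonneg _
  have t1 : 2 / s * (α ^ 2 * L * ⟪g, w⟫ - s * ⟪w, (1 - s) • V + s • Y⟫) ≤
      2 * q * ((1 + c * s) * b + (s + c) * a) := by
    calc _ = 2 / s * (α ^ 2 * L) * ⟪g, w⟫ + 2 * -⟪w, (1 - s) • V + s • Y⟫ := by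
          field_simp; ring
      _ ≤ 2 / s * (α ^ 2 * L) * (L * ((1 / (1 + s)) * (a + s * b)) * ‖w‖)
          + 2 * (‖w‖ * ((1 / (1 + s)) * (b + s * a))) := by gcongr
      _ = _ := by rw [hc, hq]; field_simp; ring
  have e : (16 + 32 * c ^ 2) / (μ * (1 + s) ^ 2) * ‖w‖ ^ 2 = (16 + 32 * c ^ 2) / μ * q ^ 2 := by
    rw [hq]; field_simp
  rw [e]
  refine t1.trans ?_
  have y1 : 2 * q * ((1 + c * s) * b) ≤ μ * b ^ 2 + (1 + c * s) ^ 2 / μ * q ^ 2 := by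
    have : 0 ≤ (μ * b - (1 + c * s) * q) ^ 2 / μ := by positivity
    have h : (μ * b - (1 + c * s) * q) ^ 2 / μ
      = μ * b ^ 2 + (1 + c * s) ^ 2 / μ * q ^ 2 - 2 * q * ((1 + c * s) * b) := by
      field_simp; ring
    linarith
  have y2 : 2 * q * ((s + c) * a) ≤ μ / 2 * a ^ 2 + 2 * (s + c) ^ 2 / μ * q ^ 2 := by
    have : 0 ≤ (μ * a - 2 * (s + c) * q) ^ 2 / (2 * μ) := by positivity
    have h : (μ * a - 2 * (s + c) * q) ^ 2 / (2 * μ)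
      = μ / 2 * a ^ 2 + 2 * (s + c) ^ 2 / μ * q ^ 2 - 2 * q * ((s + c) * a) := by
      field_simp; ring
    linarith
  have y3 : (1 + c * s) ^ 2 / μ * q ^ 2 + 2 * (s + c) ^ 2 / μ * q ^ 2
      ≤ (16 + 32 * c ^ 2) / μ * q ^ 2 := by
    rw [← add_mul, ← add_div]
    refine mul_le_mul_of_nonneg_right (div_le_div_of_nonneg_right ?_ hμ.le) (sq_nonneg q)
    have : c * s ≤ c := by nlinarith
    have : 0 ≤ c * s := by positivity
    nlinarith [sq_nonneg (1 - c), sq_nonneg (s - c)]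
  linarith

variable [CompleteSpace E]

theorem nag_line (f : E → ℝ) (hf : Differentiable ℝ f) (y z : E) (t : ℝ) :
    HasDerivAt (fun t : ℝ => f (y + t • z)) ⟪gradient f (y + t • z), z⟫ t := by
  have h := (hf (y + t • z)).hasGradientAt.hasFDerivAt
  have h2 : HasDerivAt (fun t : ℝ => y + t • z) z t := by
    simpa using ((hasDerivAt_id t).smul_const z).const_add y
  exact (h.comp_hasDerivAt t h2).congr_deriv (by simp)

theorem nag_descent (f : E → ℝ) (hf : Differentiable ℝ f) (L : ℝ)
    (hsm : ∀ x y : E, ‖gradient f x - gradient f y‖ ≤ L * ‖x - y‖) (y z : E) :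
    f (y + z) ≤ f y + ⟪gradient f y, z⟫ + L / 2 * ‖z‖ ^ 2 := by
  have hd : ∀ t : ℝ, HasDerivAt
      (fun t : ℝ => f (y + t • z) - (t * ⟪gradient f y, z⟫ + L / 2 * ‖z‖ ^ 2 * t ^ 2))
      (⟪gradient f (y + t • z), z⟫ - (⟪gradient f y, z⟫ + L / 2 * ‖z‖ ^ 2 * (2 * t))) t := by
    intro t
    refine (nag_line f hf y z t).sub (HasDerivAt.add ?_ ?_)
    · simpa using (hasDerivAt_id t).mul_const ⟪gradient f y, z⟫
    · simpa using (hasDerivAt_pow 2 t).const_mul (L / 2 * ‖z‖ ^ 2)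
  have anti := antitoneOn_of_deriv_nonpos (convex_Ici (0:ℝ))
    (fun t _ => (hd t).continuousAt.continuousWithinAt)
    (fun t _ => (hd t).differentiableAt.differentiableWithinAt) (by
      intro t ht
      rw [interior_Ici] at ht
      rw [(hd t).deriv]
      have ht' : 0 < t := ht
      have h1 : ⟪gradient f (y + t • z) - gradient f y, z⟫ ≤ L * (t * ‖z‖) * ‖z‖ := by
        refine (real_inner_le_norm _ _).trans ?_
        gcongr
        have := hsm (y + t • z) y
        rwa [add_sub_cancel_left, norm_smul, Real.norm_of_nonneg ht'.le] at this
      rw [inner_sub_left] at h1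
      linarith)
  have := anti (Set.self_mem_Ici) (show (1:ℝ) ∈ Set.Ici 0 by simp) zero_le_one
  simp at this ⊢
  linarith

theorem nag_sc (f : E → ℝ) (hf : Differentiable ℝ f) (μ : ℝ)
    (hsc : ConvexOn ℝ Set.univ (fun x => f x - μ / 2 * ‖x‖ ^ 2)) (y z : E) :
    f y + ⟪gradient f y, z⟫ + μ / 2 * ‖z‖ ^ 2 ≤ f (y + z) := by
  have hc : ConvexOn ℝ Set.univ
      (fun t : ℝ => f (y + t • z) - μ / 2 * ‖y + t • z‖ ^ 2) := by
    have := hsc.comp_affineMap (AffineMap.lineMap y (y + z) : ℝ →ᵃ[ℝ] E)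
    simpa [Function.comp_def, AffineMap.lineMap_apply, add_comm] using this
  have e : ∀ t : ℝ, ‖y + t • z‖ ^ 2 = ‖y‖ ^ 2 + t * (2 * ⟪y, z⟫) + ‖z‖ ^ 2 * t ^ 2 := by
    intro t
    rw [norm_add_sq_real, norm_smul, real_inner_smul_right, mul_pow, Real.norm_eq_abs, sq_abs]
    ring
  have hd : HasDerivAt (fun t : ℝ => f (y + t • z) - μ / 2 * ‖y + t • z‖ ^ 2)
      (⟪gradient f y, z⟫ - μ / 2 * (2 * ⟪y, z⟫)) 0 := by
    have h0 := nag_line f hf y z 0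
    simp only [zero_smul, add_zero] at h0
    refine h0.sub (HasDerivAt.const_mul _ ?_)
    simp only [e]
    have := (((hasDerivAt_id (0:ℝ)).mul_const (2 * ⟪y, z⟫)).const_add (‖y‖ ^ 2)).add
      ((hasDerivAt_pow 2 (0:ℝ)).const_mul (‖z‖ ^ 2))
    exact this.congr_deriv (by simp)
  have := hc.le_slope_of_hasDerivAt (Set.mem_univ 0) (Set.mem_univ 1) zero_lt_one hd
  rw [slope_def_field] at this
  have e1 := e 1
  simp at this e1 ⊢
  rw [e1] at this
  linarith

end helpers

/-- `O(1/K)` ergodic rate for inexact NAG (Corollary `coro-ergodic-rates`). -/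
theorem nag_ergodic_rate (d : ℕ) (hd : 1 ≤ d) (μ L : ℝ) (hμ : 0 < μ) (hμL : μ < L)
    (f : EuclideanSpace ℝ (Fin d) → ℝ) (hdiff : Differentiable ℝ f)
    (hsc : ConvexOn ℝ Set.univ (fun x => f x - μ / 2 * ‖x‖ ^ 2))
    (hsmooth : ∀ x y : EuclideanSpace ℝ (Fin d),
      ‖gradient f x - gradient f y‖ ≤ L * ‖x - y‖)
    (xstar : EuclideanSpace ℝ (Fin d)) (hmin : ∀ x, f xstar ≤ f x)
    (α : ℝ) (hα : 0 < α) (hαL : α ≤ 1 / L)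
    (β : ℝ) (hβ : β = (1 - Real.sqrt (α * μ)) / (1 + Real.sqrt (α * μ)))
    (w x y : ℕ → EuclideanSpace ℝ (Fin d))
    (hy : ∀ k : ℕ, y k = x k + β • (x k - x (k - 1)))
    (hrec : ∀ k : ℕ,
      x (k + 1) = x k - α • (gradient f (y k) + w k) + β • (x k - x (k - 1))) :
    ∀ K : ℕ,
      f (((K + 1 : ℝ))⁻¹ • ∑ j ∈ Finset.range (K + 1), x j) - f xstar ≤
        (1 / (K + 1 : ℝ)) * ∑ j ∈ Finset.range (K + 1), (f (x j) - f xstar) ∧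
      (1 / (K + 1 : ℝ)) * ∑ j ∈ Finset.range (K + 1), (f (x j) - f xstar) ≤
        LNAG μ L α ^ 2 * ((∑ j ∈ Finset.range (K + 1), ‖w j‖ ^ 2) / (K + 1 : ℝ)) +
          HbarNAG μ α f (f xstar) xstar (x 0) / (K + 1 : ℝ) -
          2 / Real.sqrt (α * μ) * ((f (x (K + 1)) - f xstar) / (K + 1 : ℝ)) := by
  intro K
  have hL0 : 0 < L := hμ.trans hμL
  have hLα : L * α ≤ 1 := by
    rw [le_div_iff₀ hL0] at hαL; linarith
  obtain ⟨s, hsdef⟩ : ∃ s, s = Real.sqrt (α * μ) := ⟨_, rfl⟩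
  have hs : 0 < s := by rw [hsdef]; positivity
  have hs2 : α * μ = s ^ 2 := by rw [hsdef, Real.sq_sqrt (by positivity)]
  have hs1 : s < 1 := by
    have : α * μ < 1 := by nlinarith
    nlinarith
  have hs' : (0:ℝ) < 1 + s := by linarith
  have hK : (0:ℝ) < (K:ℝ) + 1 := by positivity
  constructor
  · set xb := ((K + 1 : ℝ))⁻¹ • ∑ j ∈ Finset.range (K + 1), x j with hxb
    have hj : ∀ j, f xb + inner ℝ (gradient f xb) (x j - xb) ≤ f (x j) := by
      intro j
      have := nag_sc f hdiff μ hsc xb (x j - xb)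
      rw [add_sub_cancel] at this
      have : 0 ≤ μ / 2 * ‖x j - xb‖ ^ 2 := by positivity
      linarith
    have hsum := Finset.sum_le_sum (s := Finset.range (K + 1)) (fun j _ => hj j)
    rw [Finset.sum_add_distrib, ← inner_sum, Finset.sum_sub_distrib] at hsum
    have hz : ∑ j ∈ Finset.range (K + 1), x j - ∑ j ∈ Finset.range (K + 1), xb = 0 := by
      rw [Finset.sum_const, Finset.card_range, ← Nat.cast_smul_eq_nsmul ℝ, hxb, smul_smul]
      push_cast
      rw [mul_inv_cancel₀ hK.ne', one_smul, sub_self]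
    rw [hz, inner_zero_right, Finset.sum_const, Finset.card_range, nsmul_eq_mul] at hsum
    rw [Finset.sum_sub_distrib, Finset.sum_const, Finset.card_range, nsmul_eq_mul,
      one_div, inv_mul_eq_div, le_div_iff₀ hK]
    push_cast at hsum ⊢
    linarith
  · have hg0 : gradient f xstar = 0 := by
      have : IsLocalMin f xstar := Filter.Eventually.of_forall hmin
      simp [gradient, this.fderiv_eq_zero]
    set C := LNAG μ L α ^ 2 with hC
    have hCval : (16 + 32 * (α ^ 2 * L ^ 2 / s) ^ 2) / (μ * (1 + s) ^ 2)
        + 2 / s * (α * (1 + L * α) / 2) ≤ C := by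
      have hq : Real.sqrt α / Real.sqrt μ = α / s := by
        rw [hsdef, Real.sqrt_mul hα.le, div_eq_div_iff (by positivity) (by positivity)]
        linear_combination Real.sqrt μ * Real.mul_self_sqrt hα.le
      have h5 : 0 < 5 - 2 * s + α * μ := by rw [hs2]; nlinarith [sq_nonneg (1 - s)]
      rw [hC, LNAG, ← hsdef, Real.sq_sqrt (by positivity)]
      have t2 : Real.sqrt α * (1 + α * L) / Real.sqrt μ = 2 / s * (α * (1 + L * α) / 2) := by
        rw [mul_div_right_comm, hq]; field_simp
      rw [t2]
      have t1 : (16 + 32 * (α ^ 2 * L ^ 2 / s) ^ 2) / (μ * (1 + s) ^ 2)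
          = 16 / (μ * (1 + s) ^ 2) + 8 * α ^ 3 * L ^ 4 * 4 / (μ ^ 2 * (1 + s) ^ 2) := by
        rw [div_pow, ← hs2]; field_simp; ring
      rw [t1]
      have u1 : 16 / (μ * (1 + s) ^ 2) ≤ 4 * (5 - 2 * s + α * μ) / (μ * (1 + s) ^ 2) := by
        gcongr; rw [hs2]; nlinarith [sq_nonneg (1 - s)]
      have u2 : 8 * α ^ 3 * L ^ 4 * 4 / (μ ^ 2 * (1 + s) ^ 2) ≤
          8 * α ^ 3 * L ^ 4 * (4 + (1 - s) ^ 2) / (μ ^ 2 * (1 + s) ^ 2) := by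
        gcongr; nlinarith [sq_nonneg (1 - s)]
      linarith
    obtain ⟨v, hv⟩ : ∃ v : ℕ → EuclideanSpace ℝ (Fin d),
      ∀ k, v k = x k + ((1 - s) / s) • (x k - x (k - 1)) := ⟨_, fun _ => rfl⟩
    have hβ' : β = (1 - s) / (1 + s) := by rw [hβ, hsdef]
    have step : ∀ k, (f (x k) - f xstar) +
        2 / s * (f (x (k+1)) - f xstar + μ / 2 * ‖v (k+1) - xstar‖ ^ 2) ≤
        2 / s * (f (x k) - f xstar + μ / 2 * ‖v k - xstar‖ ^ 2) + C * ‖w k‖ ^ 2 := by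
      intro k
      have hX : x k - xstar = (1 + s) • (y k - xstar) - s • (v k - xstar) := by
        rw [hy, hv, hβ']
        match_scalars <;> field_simp <;> ring
      have hx' : x (k + 1) = y k + -(α • (gradient f (y k) + w k)) := by
        rw [hrec, hy]; module
      have hV : v (k+1) - xstar = (1 - s) • (v k - xstar) + s • (y k - xstar)
          - (α / s) • (gradient f (y k) + w k) := by
        rw [hv (k+1), Nat.add_sub_cancel, hrec, hv, hy, hβ']
        match_scalars <;> field_simp <;> ring
      have h1 := nag_descent f hdiff L hsmooth (y k) (-(α • (gradient f (y k) + w k)))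
      rw [← hx', inner_neg_right, real_inner_smul_right, norm_neg, norm_smul,
        Real.norm_of_nonneg hα.le, mul_pow] at h1
      have h2 := nag_sc f hdiff μ hsc (y k) (x k - y k)
      rw [add_sub_cancel] at h2
      have h3 := nag_sc f hdiff μ hsc (y k) (xstar - y k)
      rw [add_sub_cancel, ← neg_sub (y k) xstar, inner_neg_right, norm_neg] at h3
      have h4 := hsmooth (y k) xstar
      rw [hg0, sub_zero] at h4
      have h5 := nag_sc f hdiff μ hsc xstar (x k - xstar)
      rw [add_sub_cancel, hg0, inner_zero_left] at h5
      have A := nag_stepA μ L α s hμ hs hs1 hs2 hα hLα (x k - xstar) (y k - xstar)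
        (v k - xstar) (v (k+1) - xstar) (gradient f (y k)) (w k) (f (x k) - f xstar)
        (f (y k) - f xstar) (f (x (k+1)) - f xstar) hX hV (by linarith)
        (by rw [sub_sub_sub_cancel_right]; linarith) (by linarith)
      have B := nag_stepB μ L α s hμ hs hs1 hL0 hα (x k - xstar) (y k - xstar)
        (v k - xstar) (gradient f (y k)) (w k) hX h4
      have A' := mul_le_mul_of_nonneg_left A (by positivity : 0 ≤ 2 / s)
      have D := mul_le_mul_of_nonneg_right hCval (sq_nonneg ‖w k‖)
      have e : 2 / s * ((1 - s) * (f (x k) - f xstar + μ / 2 * ‖v k - xstar‖ ^ 2))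
        = 2 / s * (f (x k) - f xstar + μ / 2 * ‖v k - xstar‖ ^ 2)
          - 2 * (f (x k) - f xstar + μ / 2 * ‖v k - xstar‖ ^ 2) := by field_simp
      linarith
    have tele : ∀ n, ∑ j ∈ Finset.range n, (f (x j) - f xstar) +
        2 / s * (f (x n) - f xstar + μ / 2 * ‖v n - xstar‖ ^ 2) ≤
        2 / s * (f (x 0) - f xstar + μ / 2 * ‖v 0 - xstar‖ ^ 2)
          + C * ∑ j ∈ Finset.range n, ‖w j‖ ^ 2 := by
      intro n
      induction n with
      | zero => simp
      | succ n ih =>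
        rw [Finset.sum_range_succ, Finset.sum_range_succ, mul_add]
        linarith [step n]
    have T := tele (K + 1)
    have hv0 : v 0 = x 0 := by rw [hv]; simp
    rw [hv0] at T
    have hF0 : 0 ≤ f (x 0) - f xstar := sub_nonneg.2 (hmin _)
    have hH : 2 / s * (f (x 0) - f xstar + μ / 2 * ‖x 0 - xstar‖ ^ 2) ≤
        HbarNAG μ α f (f xstar) xstar (x 0) := by
      rw [HbarNAG, ← hsdef]
      have h5 : 0 < 5 - 2 * s + α * μ := by rw [hs2]; nlinarith [sq_nonneg (1 - s)]
      have h6 : 0 ≤ 1 - s := by linarith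
      have q1 : 0 ≤ s * (1 - s) / (4 * (5 - 2 * s + α * μ)) := by positivity
      have q2 : 0 ≤ s * (1 - s) ^ 2 / (4 * (4 + (1 - s) ^ 2)) := by positivity
      have q3 : 2 / s ≤ 2 / s * (1 + s * (1 - s) / (4 * (5 - 2 * s + α * μ)) +
          s * (1 - s) ^ 2 / (4 * (4 + (1 - s) ^ 2))) :=
        le_mul_of_one_le_right (by positivity) (by linarith)
      exact mul_le_mul_of_nonneg_right q3 (by positivity)
    have hlast : 0 ≤ 2 / s * (μ / 2 * ‖v (K + 1) - xstar‖ ^ 2) := by positivity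
    rw [← hsdef]
    have fin : ∑ j ∈ Finset.range (K + 1), (f (x j) - f xstar) ≤
        C * ∑ j ∈ Finset.range (K + 1), ‖w j‖ ^ 2 + HbarNAG μ α f (f xstar) xstar (x 0)
          - 2 / s * (f (x (K + 1)) - f xstar) := by
      rw [mul_add] at T; linarith
    have := mul_le_mul_of_nonneg_left fin (by positivity : (0:ℝ) ≤ 1 / (K + 1))
    refine this.trans (le_of_eq ?_)
    ring
end
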